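/- arXiv:2111.09444 — 3 statements merged into one kernel-verified Lean document; each statement's English description precedes it below -/
import Mathlib

section
/- Let (X,Π) be a d-dimensional weighted pure simplicial complex and f ∈ C_k for some k ≤ d. Then for every 0 ≤ i ≤ k, the Bottom-Up level function has the explicit form g_i = Σ_{j=0}^{i} (−1)^{i−j}·C(i,j)·U_j^i D_j^k f; equivalently, for every τ ∈ X(i), g_i(τ) = Σ_{σ ⊆ τ} (−1)^{|τ∖σ|}·E_{X_σ}[f]. -/
open Finset

/-- Functions on faces of a complex on vertex set `Fin n`. -/
abbrev Cf (n : ℕ) := Finset (Fin n) → ℝ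

/-- A `d`-dimensional weighted pure simplicial complex on vertex set `Fin n`:
the downward closure of a `d`-uniform hypergraph `faces d`, together with a
probability distribution on the top faces inducing distributions `w i` on each
level `faces i` via `π_i(x) = (1/(i+1))·Σ_{y ⊃ x} π_{i+1}(y)`. -/
structure WSC (n d : ℕ) where
  faces : ℕ → Finset (Finset (Fin n))
  top_nonempty : (faces d).Nonempty
  card_mem : ∀ i, ∀ s ∈ faces i, s.card = i
  empty_levels : ∀ i, d < i → faces i = ∅
  downward : ∀ i, i < d → ∀ s : Finset (Fin n),
    s ∈ faces i ↔ (s.card = i ∧ ∃ t ∈ faces (i+1), s ⊆ t)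
  w : ℕ → Finset (Fin n) → ℝ
  w_nonneg : ∀ i s, 0 ≤ w i s
  w_pos : ∀ i, ∀ s ∈ faces i, 0 < w i s
  w_zero : ∀ i s, s ∉ faces i → w i s = 0
  w_top_sum : ∑ s ∈ faces d, w d s = 1
  w_rec : ∀ i, i < d → ∀ s ∈ faces i,
    w i s = (1/(i+1 : ℝ)) * ∑ t ∈ (faces (i+1)).filter (fun t => s ⊆ t), w (i+1) t

variable {n d : ℕ}

/-- The up operator `U_k : C_k → C_{k+1}`. -/
noncomputable def Uop (X : WSC n d) (k : ℕ) (f : Cf n) : Cf n := fun τ =>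
  (1/(k+1 : ℝ)) * ∑ σ ∈ (X.faces k).filter (fun σ => σ ⊆ τ), f σ

/-- The down operator `D_{k+1} : C_{k+1} → C_k`. -/
noncomputable def Dop (X : WSC n d) (k : ℕ) (f : Cf n) : Cf n := fun τ =>
  (∑ σ ∈ (X.faces (k+1)).filter (fun σ => τ ⊆ σ), X.w (k+1) σ * f σ) /
  (∑ σ ∈ (X.faces (k+1)).filter (fun σ => τ ⊆ σ), X.w (k+1) σ)

/-- `Uc X i m : C_i → C_{i+m}` is the iterated up operator; `U_i^k = Uc X i (k-i)`. -/
noncomputable def Uc (X : WSC n d) (i : ℕ) : ℕ → Cf n → Cf n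
  | 0, f => f
  | m+1, f => Uop X (i+m) (Uc X i m f)

/-- `Dc X k m : C_k → C_{k-m}` is the iterated down operator; `D_i^k = Dc X k (k-i)`. -/
noncomputable def Dc (X : WSC n d) (k : ℕ) : ℕ → Cf n → Cf n
  | 0, f => f
  | m+1, f => Dop X (k - (m+1)) (Dc X k m f)

/-- Bottom-Up level functions: `g_i = D_i^k f − Σ_{j<i} C(i,j)·U_j^i g_j ∈ C_i`. -/
noncomputable def gLevel (X : WSC n d) (k : ℕ) (f : Cf n) : ℕ → Cf n
  | i => Dc X k (k - i) f - ∑ j ∈ (Finset.range i).attach,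
      ((i.choose j.1 : ℝ)) • Uc X j.1 (i - j.1) (gLevel X k f j.1)
  termination_by i => i
  decreasing_by exact Finset.mem_range.mp j.2

/-- Lifted Bottom-Up level functions: `f_i^↑ = C(k,i)·U_i^k g_i ∈ C_k`. -/
noncomputable def fLevel (X : WSC n d) (k : ℕ) (f : Cf n) (i : ℕ) : Cf n :=
  ((k.choose i : ℝ)) • Uc X i (k - i) (gLevel X k f i)

/-- Inner product at level `i`: `⟨f,g⟩ = E_{τ∼π_i}[f(τ)g(τ)]`. -/
noncomputable def ip (X : WSC n d) (i : ℕ) (f g : Cf n) : ℝ :=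
  ∑ τ ∈ X.faces i, X.w i τ * f τ * g τ

/-- Expectation at level `i`. -/
noncomputable def EE (X : WSC n d) (i : ℕ) (f : Cf n) : ℝ :=
  ∑ τ ∈ X.faces i, X.w i τ * f τ

/-- `L²` norm at level `i`. -/
noncomputable def norm2 (X : WSC n d) (i : ℕ) (f : Cf n) : ℝ := Real.sqrt (ip X i f f)

/-- `L^p` norm at level `i`. -/
noncomputable def normP (X : WSC n d) (i : ℕ) (p : ℝ) (f : Cf n) : ℝ :=
  (∑ τ ∈ X.faces i, X.w i τ * |f τ| ^ p) ^ (1/p)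

/-- `L^∞` norm at level `i` : the maximum of `|f|` over `i`-faces. -/
noncomputable def normInf (X : WSC n d) (i : ℕ) (f : Cf n) : ℝ :=
  ⨆ τ : {σ // σ ∈ X.faces i}, |f τ.1|

/-- `E_{X_τ}[f|_τ]`: the weighted mean of `f ∈ C_k` over `k`-faces containing `τ`. -/
noncomputable def linkMean (X : WSC n d) (k : ℕ) (τ : Finset (Fin n)) (f : Cf n) : ℝ :=
  (∑ ρ ∈ (X.faces k).filter (fun ρ => τ ⊆ ρ), X.w k ρ * f ρ) /
  (∑ ρ ∈ (X.faces k).filter (fun ρ => τ ⊆ ρ), X.w k ρ)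

/-- `⟨f|_τ, g|_τ⟩` over the link `X_τ` with its induced distribution, for `f, g ∈ C_k`. -/
noncomputable def linkIp (X : WSC n d) (k : ℕ) (τ : Finset (Fin n)) (f g : Cf n) : ℝ :=
  (∑ ρ ∈ (X.faces k).filter (fun ρ => τ ⊆ ρ), X.w k ρ * f ρ * g ρ) /
  (∑ ρ ∈ (X.faces k).filter (fun ρ => τ ⊆ ρ), X.w k ρ)

/-- `f ∈ C_k` is `(ε,i)`-pseudorandom: `|E_{X_τ}[f|_τ]| ≤ ε‖f‖_∞` and
`⟨f|_τ,f|_τ⟩ ≤ ε‖f‖_∞²` for every `i`-face `τ`. -/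
def Pseudorandom (X : WSC n d) (k : ℕ) (ε : ℝ) (i : ℕ) (f : Cf n) : Prop :=
  ∀ τ ∈ X.faces i, |linkMean X k τ f| ≤ ε * normInf X k f ∧
    linkIp X k τ f f ≤ ε * (normInf X k f)^2

/-- Boolean ({0,1}-valued) function on `X(k)`. -/
def IsBool (X : WSC n d) (k : ℕ) (f : Cf n) : Prop := ∀ τ ∈ X.faces k, f τ = 0 ∨ f τ = 1

/-- Total influence `I[f] = ⟨f, k(Id − U_{k−1}D_k) f⟩`. -/
noncomputable def influence (X : WSC n d) (k : ℕ) (f : Cf n) : ℝ :=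
  (k : ℝ) * (ip X k f f - ip X k f (Uop X (k-1) (Dop X (k-1) f)))

/-- Variance `Var(f) = E[f²] − E[f]²`. -/
noncomputable def variance (X : WSC n d) (k : ℕ) (f : Cf n) : ℝ :=
  ip X k f f - (EE X k f)^2

/-- The noise operator `T_ρ = Σ_{i=0}^k C(k,i)(1−ρ)^i ρ^{k−i} U_{k−i}^k D_{k−i}^k`. -/
noncomputable def noiseOp (X : WSC n d) (k : ℕ) (ρ : ℝ) (f : Cf n) : Cf n :=
  ∑ i ∈ Finset.range (k+1),
    ((k.choose i : ℝ) * (1-ρ)^i * ρ^(k-i)) • Uc X (k-i) i (Dc X k i f)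

/-- Noise stability `Stab_ρ(f) = ⟨f, T_ρ f⟩`. -/
noncomputable def stab (X : WSC n d) (k : ℕ) (ρ : ℝ) (f : Cf n) : ℝ :=
  ip X k f (noiseOp X k ρ f)

/-- Edge weights of the underlying graph of the link of `s ∈ X(i)`. -/
noncomputable def edgeW (X : WSC n d) (i : ℕ) (s : Finset (Fin n)) (u v : Fin n) : ℝ :=
  if u ≠ v ∧ u ∉ s ∧ v ∉ s ∧ insert u (insert v s) ∈ X.faces (i+2)
  then X.w (i+2) (insert u (insert v s)) else 0

/-- Vertex weights of the underlying graph of the link of `s ∈ X(i)`. -/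
noncomputable def vertW (X : WSC n d) (i : ℕ) (s : Finset (Fin n)) (u : Fin n) : ℝ :=
  ∑ v, edgeW X i s u v

/-- `X` is a two-sided `γ`-local-spectral expander: for every `i ≤ d−2` and every
`s ∈ X(i)` (including `s = ∅`), every nontrivial eigenvalue of the weighted adjacency
operator of the graph `(X_s(1), X_s(2))` has absolute value at most `γ`, expressed via
the quadratic form on functions orthogonal to constants. -/
def IsLSE (X : WSC n d) (γ : ℝ) : Prop :=
  ∀ i, i + 2 ≤ d → ∀ s ∈ X.faces i, ∀ f : Fin n → ℝ,
    (∑ u, vertW X i s u * f u) = 0 →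
    |∑ u, ∑ v, edgeW X i s u v * f u * f v| ≤ γ * ∑ u, vertW X i s u * (f u)^2

/-- The swap walk `S_{j,i} : C_i → C_j`: `(S_{j,i} f)(τ)` is the weighted mean of `f(σ)`
over `i`-faces `σ` disjoint from `τ` with `τ ∪ σ ∈ X(i+j)`. -/
noncomputable def swapW (X : WSC n d) (j i : ℕ) (f : Cf n) : Cf n := fun τ =>
  (∑ σ ∈ (X.faces i).filter (fun σ => Disjoint σ τ ∧ σ ∪ τ ∈ X.faces (i+j)),
      X.w (i+j) (σ ∪ τ) * f σ) /
  (∑ σ ∈ (X.faces i).filter (fun σ => Disjoint σ τ ∧ σ ∪ τ ∈ X.faces (i+j)),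
      X.w (i+j) (σ ∪ τ))

/-- Localized mean: `E_{σ ∼ π_{v,i}}[f(σ)]`, the mean of `f ∈ C_i` over the `i`-faces of
the link `X_v` of `v ∈ X(j)`, with respect to the distribution induced by the link. -/
noncomputable def locMean (X : WSC n d) (i j : ℕ) (v : Finset (Fin n)) (f : Cf n) : ℝ :=
  (∑ σ ∈ (X.faces i).filter (fun σ => Disjoint σ v ∧ σ ∪ v ∈ X.faces (i+j)),
      X.w (i+j) (σ ∪ v) * f σ) /
  (∑ σ ∈ (X.faces i).filter (fun σ => Disjoint σ v ∧ σ ∪ v ∈ X.faces (i+j)),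
      X.w (i+j) (σ ∪ v))

/-- The `m`-faces of the link `X_τ`. -/
noncomputable def lkFaces (X : WSC n d) (τ : Finset (Fin n)) (m : ℕ) : Finset (Finset (Fin n)) :=
  (Finset.univ : Finset (Finset (Fin n))).filter
    (fun σ => Disjoint σ τ ∧ σ ∪ τ ∈ X.faces (τ.card + m))

/-- Inner product at level `m` of the link `X_τ` (with the induced distribution). -/
noncomputable def lkIp (X : WSC n d) (τ : Finset (Fin n)) (m : ℕ) (f g : Cf n) : ℝ :=
  (∑ σ ∈ lkFaces X τ m, X.w (τ.card + m) (σ ∪ τ) * f σ * g σ) /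
  (∑ σ ∈ lkFaces X τ m, X.w (τ.card + m) (σ ∪ τ))

/-- `L²` norm at level `m` of the link `X_τ`. -/
noncomputable def lkNorm2 (X : WSC n d) (τ : Finset (Fin n)) (m : ℕ) (f : Cf n) : ℝ :=
  Real.sqrt (lkIp X τ m f f)

/-- Global mean at level `m` of the link `X_τ` (the stationary operator `U_0^j D_0^m`
of the swap walk on `X_τ` applied to `f`). -/
noncomputable def lkMeanLvl (X : WSC n d) (τ : Finset (Fin n)) (m : ℕ) (f : Cf n) : ℝ :=
  (∑ σ ∈ lkFaces X τ m, X.w (τ.card + m) (σ ∪ τ) * f σ) /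
  (∑ σ ∈ lkFaces X τ m, X.w (τ.card + m) (σ ∪ τ))

/-- The swap walk `S_{j,m}` within the link `X_τ`. -/
noncomputable def lkSwap (X : WSC n d) (τ : Finset (Fin n)) (j m : ℕ) (f : Cf n) : Cf n := fun v =>
  (∑ σ ∈ (lkFaces X τ m).filter (fun σ => Disjoint σ v ∧ σ ∪ v ∈ lkFaces X τ (m+j)),
      X.w (τ.card + m + j) (σ ∪ v ∪ τ) * f σ) /
  (∑ σ ∈ (lkFaces X τ m).filter (fun σ => Disjoint σ v ∧ σ ∪ v ∈ lkFaces X τ (m+j)),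
      X.w (τ.card + m + j) (σ ∪ v ∪ τ))

/-- Restriction `f|_τ(σ) = f(τ ∪ σ)`. -/
def restrictF (τ : Finset (Fin n)) (f : Cf n) : Cf n := fun σ => f (τ ∪ σ)

/-- The Bottom-Up level function of the restriction `f|_υ` computed within the link
`X_υ` (via its explicit form): `g_ℓ^{(υ)}(I) = Σ_{T ⊆ I} (−1)^{|I∖T|}·E_{(X_υ)_T}[f|_υ]`. -/
noncomputable def gLink (X : WSC n d) (k : ℕ) (f : Cf n) (υ : Finset (Fin n)) : Cf n :=
  fun I => ∑ σ ∈ I.powerset, (-1:ℝ)^((I \ σ).card) * linkMean X k (υ ∪ σ) f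

theorem WSC.mem_faces_of_subset (X : WSC n d) {i : ℕ} {τ σ : Finset (Fin n)}
    (hτ : τ ∈ X.faces i) (h : σ ⊆ τ) : σ ∈ X.faces σ.card := by
  induction i generalizing τ with
  | zero =>
    have hτ0 : τ = ∅ := card_eq_zero.mp (X.card_mem 0 τ hτ)
    subst hτ0
    obtain rfl := subset_empty.mp h
    simpa using hτ
  | succ i ih =>
    have hcard := X.card_mem _ τ hτ
    rcases eq_or_ssubset_of_subset h with rfl | hss
    · rwa [hcard]
    · obtain ⟨a, haτ, haσ⟩ := exists_of_ssubset hss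
      have hid : i < d := by
        by_contra hlt
        rw [X.empty_levels (i + 1) (by omega)] at hτ
        simp at hτ
      refine ih (τ := τ.erase a) ?_ (subset_erase.mpr ⟨h, haσ⟩)
      refine (X.downward i hid _).mpr ⟨?_, τ, hτ, erase_subset _ _⟩
      rw [card_erase_of_mem haτ, hcard, Nat.add_sub_cancel]

theorem WSC.filter_faces_subset (X : WSC n d) {i : ℕ} {τ : Finset (Fin n)}
    (hτ : τ ∈ X.faces i) (j : ℕ) :
    (X.faces j).filter (fun σ => σ ⊆ τ) = τ.powersetCard j := by
  ext σ
  simp only [mem_filter, mem_powersetCard]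
  constructor
  · rintro ⟨hσ, h⟩
    exact ⟨h, X.card_mem _ _ hσ⟩
  · rintro ⟨h, rfl⟩
    exact ⟨X.mem_faces_of_subset hτ h, h⟩

theorem WSC.filter_faces_superset (X : WSC n d) {k : ℕ} {σ : Finset (Fin n)}
    (hσ : σ ∈ X.faces k) : (X.faces k).filter (fun υ => σ ⊆ υ) = {σ} := by
  ext υ
  simp only [mem_filter, mem_singleton]
  constructor
  · rintro ⟨hυ, hsub⟩
    exact (eq_of_subset_of_card_le hsub
      (by rw [X.card_mem _ _ hυ, X.card_mem _ _ hσ])).symm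
  · rintro rfl
    exact ⟨hσ, Subset.rfl⟩

/-- `C(j+m,j)·U_j^{j+m} h` sums `h` over the `j`-subsets of a `(j+m)`-face. -/
theorem choose_mul_Uc (X : WSC n d) (h : Cf n) (j m : ℕ) {τ : Finset (Fin n)}
    (hτ : τ ∈ X.faces (j + m)) :
    ((j + m).choose j : ℝ) * Uc X j m h τ = ∑ σ ∈ τ.powersetCard j, h σ := by
  induction m generalizing τ with
  | zero =>
    have hcard : τ.card = j := X.card_mem _ _ hτ
    subst hcard
    simp [Uc]
  | succ m ih =>
    have hcard : τ.card = j + m + 1 := X.card_mem _ _ hτ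
    have hU : ((j + m : ℕ) + 1 : ℝ) * Uc X j (m + 1) h τ =
        ∑ ρ ∈ τ.powersetCard (j + m), Uc X j m h ρ := by
      rw [Uc, Uop, X.filter_faces_subset hτ]
      have : ((j + m : ℕ) + 1 : ℝ) ≠ 0 := by positivity
      field_simp
    have hsum : ((j + m).choose j : ℝ) * ∑ ρ ∈ τ.powersetCard (j + m), Uc X j m h ρ =
        (m + 1 : ℝ) * ∑ σ ∈ τ.powersetCard j, h σ := by
      rw [mul_sum]
      calc _ = ∑ ρ ∈ τ.powersetCard (j + m), ∑ σ ∈ ρ.powersetCard j, h σ := by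
            refine sum_congr rfl fun ρ hρ => ih ?_
            obtain ⟨hsub, hρc⟩ := mem_powersetCard.mp hρ
            exact hρc ▸ X.mem_faces_of_subset hτ hsub
        _ = ∑ σ ∈ τ.powersetCard j, ∑ ρ ∈ (τ.powersetCard (j + m)).filter (σ ⊆ ·), h σ := by
            refine sum_comm' fun ρ σ => ?_
            simp only [mem_powersetCard, mem_filter]
            constructor
            · rintro ⟨⟨h1, h2⟩, h3, h4⟩
              exact ⟨⟨⟨h1, h2⟩, h3⟩, h3.trans h1, h4⟩
            · rintro ⟨⟨⟨h1, h2⟩, h3⟩, -, h4⟩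
              exact ⟨⟨h1, h2⟩, h3, h4⟩
        _ = _ := by
            rw [mul_sum]
            refine sum_congr rfl fun σ hσ => ?_
            obtain ⟨hsub, hσc⟩ := mem_powersetCard.mp hσ
            rw [sum_const, nsmul_eq_mul,
              card_filter_powersetCard_subset σ τ (j + m) hsub (by omega), hcard, hσc,
              show j + m + 1 - j = m + 1 by omega, show j + m - j = m by omega,
              Nat.choose_succ_self_right]
            push_cast
            ring
    have hchoose : ((j + m + 1).choose j : ℝ) * (m + 1) =
        ((j + m : ℕ) + 1) * ((j + m).choose j : ℝ) := by
      have := Nat.choose_mul_succ_eq (j + m) j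
      rw [show j + m + 1 - j = m + 1 by omega] at this
      have h' : ((j + m).choose j : ℝ) * ((j + m : ℕ) + 1) =
          ((j + m + 1).choose j : ℝ) * (m + 1) := by exact_mod_cast this
      linarith
    have hm : (m + 1 : ℝ) ≠ 0 := by positivity
    apply mul_left_cancel₀ hm
    rw [← hsum, ← hU]
    rw [show j + (m + 1) = j + m + 1 by omega]
    linear_combination Uc X j (m + 1) h τ * hchoose

/-- Every `k`-face above a `j`-face `σ` contains `k - j` faces of size `j + 1` above `σ`. -/
theorem sum_cofaces_sum_cofaces (X : WSC n d) (F : Cf n) {j : ℕ} (k : ℕ)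
    {σ : Finset (Fin n)} (hσ : σ ∈ X.faces j) :
    ∑ ρ ∈ (X.faces (j + 1)).filter (fun ρ => σ ⊆ ρ),
        ∑ υ ∈ (X.faces k).filter (fun υ => ρ ⊆ υ), F υ =
      ((k - j : ℕ) : ℝ) * ∑ υ ∈ (X.faces k).filter (fun υ => σ ⊆ υ), F υ := by
  have hσc := X.card_mem _ _ hσ
  calc _ = ∑ υ ∈ (X.faces k).filter (fun υ => σ ⊆ υ),
        ∑ ρ ∈ (υ.powersetCard (j + 1)).filter (σ ⊆ ·), F υ := by
        refine sum_comm' fun ρ υ => ?_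
        simp only [mem_powersetCard, mem_filter]
        constructor
        · rintro ⟨⟨h1, h2⟩, h3, h4⟩
          exact ⟨⟨⟨h4, X.card_mem _ _ h1⟩, h2⟩, h3, h2.trans h4⟩
        · rintro ⟨⟨⟨h1, h2⟩, h3⟩, h4, -⟩
          exact ⟨⟨h2 ▸ X.mem_faces_of_subset h4 h1, h3⟩, h4, h1⟩
    _ = _ := by
        rw [mul_sum]
        refine sum_congr rfl fun υ hυ => ?_
        obtain ⟨hυ, hsub⟩ := mem_filter.mp hυ
        rw [sum_const, nsmul_eq_mul,
          card_filter_powersetCard_subset σ υ (j + 1) hsub (by omega), X.card_mem _ _ hυ, hσc,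
          Nat.add_sub_cancel_left, Nat.choose_one_right]

/-- The `k`-faces above a `j`-face `σ` have total weight `C(k,j)·π_j(σ)`. -/
theorem sum_cofaces_w (X : WSC n d) {k : ℕ} (hk : k ≤ d) {j : ℕ} (hjk : j ≤ k)
    {σ : Finset (Fin n)} (hσ : σ ∈ X.faces j) :
    ∑ υ ∈ (X.faces k).filter (fun υ => σ ⊆ υ), X.w k υ = (k.choose j : ℝ) * X.w j σ := by
  induction hjk using Nat.decreasingInduction generalizing σ with
  | self =>
    simp [X.filter_faces_superset hσ]
  | of_succ j hjk ih =>
    have hdouble := sum_cofaces_sum_cofaces X (X.w k) k hσ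
    rw [sum_congr rfl fun ρ hρ => ih (mem_filter.mp hρ).1, ← mul_sum] at hdouble
    have hrec := X.w_rec j (by omega) σ hσ
    have hchoose : (k.choose (j + 1) : ℝ) * (j + 1) = (k.choose j : ℝ) * ((k - j : ℕ) : ℝ) := by
      exact_mod_cast Nat.choose_succ_right_eq k j
    have hkj : ((k - j : ℕ) : ℝ) ≠ 0 := by
      exact_mod_cast (Nat.sub_pos_of_lt hjk).ne'
    have hj : (j + 1 : ℝ) ≠ 0 := by positivity
    have hrec' : (j + 1 : ℝ) * X.w j σ =
        ∑ t ∈ (X.faces (j + 1)).filter (fun t => σ ⊆ t), X.w (j + 1) t := by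
      rw [hrec]
      field_simp
    apply mul_left_cancel₀ hkj
    rw [← hdouble, ← hrec']
    linear_combination X.w j σ * hchoose

/-- `D_j^k f` is the mean of `f` over the link. -/
theorem Dc_eq_linkMean (X : WSC n d) {k : ℕ} (hk : k ≤ d) (f : Cf n) {j : ℕ} (hjk : j ≤ k)
    {σ : Finset (Fin n)} (hσ : σ ∈ X.faces j) :
    Dc X k (k - j) f σ = linkMean X k σ f := by
  induction hjk using Nat.decreasingInduction generalizing σ with
  | self =>
    have hw := (X.w_pos k σ hσ).ne'
    simp only [Nat.sub_self, Dc, linkMean, X.filter_faces_superset hσ,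
      sum_singleton]
    field_simp
  | of_succ j hjk ih =>
    have hc : (k.choose (j + 1) : ℝ) ≠ 0 := by
      exact_mod_cast (Nat.choose_pos hjk).ne'
    have hkj : ((k - j : ℕ) : ℝ) ≠ 0 := by
      exact_mod_cast (Nat.sub_pos_of_lt hjk).ne'
    have hden := sum_cofaces_sum_cofaces X (X.w k) k hσ
    rw [sum_congr rfl fun ρ hρ => sum_cofaces_w X hk hjk (mem_filter.mp hρ).1,
      ← mul_sum] at hden
    have hnum : (k.choose (j + 1) : ℝ) *
        ∑ ρ ∈ (X.faces (j + 1)).filter (fun ρ => σ ⊆ ρ),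
          X.w (j + 1) ρ * Dc X k (k - (j + 1)) f ρ =
        ((k - j : ℕ) : ℝ) * ∑ υ ∈ (X.faces k).filter (fun υ => σ ⊆ υ), X.w k υ * f υ := by
      rw [← sum_cofaces_sum_cofaces X (fun υ => X.w k υ * f υ) k hσ, mul_sum]
      refine sum_congr rfl fun ρ hρ => ?_
      have hρ := (mem_filter.mp hρ).1
      have hw := (X.w_pos _ ρ hρ).ne'
      rw [ih hρ, linkMean, sum_cofaces_w X hk hjk hρ]
      field_simp
    rw [show k - j = k - (j + 1) + 1 by omega, Dc,
      show k - (k - (j + 1) + 1) = j by omega, Dop, linkMean,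
      ← mul_div_mul_left _ _ hc, hnum, hden, mul_div_mul_left _ _ hkj]

/-- Möbius inversion on the Boolean lattice. -/
theorem sum_powerset_sum_powerset_neg_one_pow {α : Type*} [DecidableEq α]
    (L : Finset α → ℝ) (τ : Finset α) :
    ∑ σ ∈ τ.powerset, ∑ ρ ∈ σ.powerset, (-1 : ℝ) ^ (σ \ ρ).card * L ρ = L τ := by
  calc _ = ∑ ρ ∈ τ.powerset, ∑ σ ∈ Icc ρ τ, (-1 : ℝ) ^ (σ \ ρ).card * L ρ := by
        refine sum_comm' fun σ ρ => ?_
        simp only [mem_powerset, mem_Icc]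
        constructor
        · rintro ⟨h1, h2⟩
          exact ⟨⟨h2, h1⟩, h2.trans h1⟩
        · rintro ⟨⟨h1, h2⟩, -⟩
          exact ⟨h2, h1⟩
    _ = ∑ ρ ∈ τ.powerset, if ρ = τ then L ρ else 0 := by
        refine sum_congr rfl fun ρ hρ => ?_
        have hsub := mem_powerset.mp hρ
        have hdisj : ∀ u ∈ (τ \ ρ).powerset, Disjoint u ρ := fun u hu =>
          disjoint_of_subset_left (mem_powerset.mp hu) sdiff_disjoint
        rw [← sum_mul, Icc_eq_image_powerset hsub, sum_image]
        · rw [sum_congr rfl fun u hu => by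
            rw [union_sdiff_cancel_left (hdisj u hu).symm]]
          have hcast : ∑ u ∈ (τ \ ρ).powerset, (-1 : ℝ) ^ u.card =
              ((∑ u ∈ (τ \ ρ).powerset, (-1 : ℤ) ^ u.card : ℤ) : ℝ) := by push_cast; rfl
          rw [hcast, sum_powerset_neg_one_pow_card]
          have : τ \ ρ = ∅ ↔ ρ = τ := by
            rw [sdiff_eq_empty_iff_subset]
            exact ⟨fun h => hsub.antisymm h, fun h => h ▸ Subset.rfl⟩
          simp [this]
        · intro u hu v hv huv
          have huv : ρ ∪ u = ρ ∪ v := huv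
          rw [← union_sdiff_cancel_left (hdisj u hu).symm, huv,
            union_sdiff_cancel_left (hdisj v hv).symm]
    _ = L τ := by simp

theorem gLevel_eq_sum_linkMean (X : WSC n d) {k : ℕ} (hk : k ≤ d) (f : Cf n) {i : ℕ}
    (hik : i ≤ k) {τ : Finset (Fin n)} (hτ : τ ∈ X.faces i) :
    gLevel X k f i τ = ∑ σ ∈ τ.powerset, (-1 : ℝ) ^ (τ \ σ).card * linkMean X k σ f := by
  induction i using Nat.strong_induction_on generalizing τ with
  | _ i ih =>
  have hcard := X.card_mem _ _ hτ
  have hmoebius := sum_powerset_sum_powerset_neg_one_pow (fun σ => linkMean X k σ f) τ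
  rw [sum_powerset, hcard, sum_range_succ, ← hcard, powersetCard_self, sum_singleton,
    hcard] at hmoebius
  rw [gLevel, Pi.sub_apply, sum_attach (range i)
    (fun j => (i.choose j : ℝ) • Uc X j (i - j) (gLevel X k f j)), Finset.sum_apply,
    Dc_eq_linkMean X hk f hik hτ, sub_eq_iff_eq_add, ← hmoebius, add_comm]
  congr 1
  refine sum_congr rfl fun j hj => ?_
  have hji := mem_range.mp hj
  have hadd : j + (i - j) = i := by omega
  have hU := choose_mul_Uc X (gLevel X k f j) j (i - j) (τ := τ) (by rwa [hadd])
  rw [hadd] at hU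
  rw [Pi.smul_apply, smul_eq_mul, hU]
  refine sum_congr rfl fun σ hσ => ?_
  obtain ⟨hsub, hσc⟩ := mem_powersetCard.mp hσ
  exact (ih j hji (by omega) (hσc ▸ X.mem_faces_of_subset hτ hsub)).symm

/-- Bottom-Up explicit form: for a `d`-dimensional weighted pure
simplicial complex and `f ∈ C_k`, the recursive Bottom-Up level function `g_i` has the
explicit form `g_i = Σ_{j=0}^{i} (−1)^{i−j}·C(i,j)·U_j^i D_j^k f`; equivalently, for
every `τ ∈ X(i)`, `g_i(τ) = Σ_{σ ⊆ τ} (−1)^{|τ∖σ|}·E_{X_σ}[f]`. -/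
theorem stmt0 (n d : ℕ) (X : WSC n d) (k : ℕ) (hk : k ≤ d) (f : Cf n)
    (i : ℕ) (hik : i ≤ k) :
    (∀ τ ∈ X.faces i,
      gLevel X k f i τ =
        ∑ j ∈ Finset.range (i+1),
          (-1:ℝ)^(i-j) * (i.choose j : ℝ) * Uc X j (i-j) (Dc X k (k-j) f) τ) ∧
    (∀ τ ∈ X.faces i,
      gLevel X k f i τ = ∑ σ ∈ τ.powerset, (-1:ℝ)^((τ \ σ).card) * linkMean X k σ f) := by
  refine ⟨fun τ hτ => ?_, fun τ hτ => gLevel_eq_sum_linkMean X hk f hik hτ⟩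
  have hcard := X.card_mem _ _ hτ
  rw [gLevel_eq_sum_linkMean X hk f hik hτ, sum_powerset, hcard]
  refine sum_congr rfl fun j hj => ?_
  have hji : j ≤ i := Nat.lt_succ_iff.mp (mem_range.mp hj)
  have hadd : j + (i - j) = i := by omega
  have hU := choose_mul_Uc X (Dc X k (k - j) f) j (i - j) (τ := τ) (by rwa [hadd])
  rw [hadd] at hU
  rw [mul_assoc, hU, mul_sum]
  refine sum_congr rfl fun σ hσ => ?_
  obtain ⟨hsub, hσc⟩ := mem_powersetCard.mp hσ
  rw [card_sdiff_of_subset hsub, hcard, hσc,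
    Dc_eq_linkMean X hk f (hji.trans hik) (hσc ▸ X.mem_faces_of_subset hτ hsub)]
end

section
/- Let (X,Π) be a d-dimensional weighted pure simplicial complex and f ∈ C_k. Then for every i ≤ k and every p ∈ [1,∞], the Bottom-Up level function satisfies ‖g_i‖_p ≤ 2^i·‖D_i^k f‖_p. -/
open Finset

variable {n d : ℕ}

namespace WSC

lemma filter_subset_eq_powersetCard (X : WSC n d) {i : ℕ} (hi : i < d) {τ : Finset (Fin n)}
    (hτ : τ ∈ X.faces (i + 1)) :
    (X.faces i).filter (fun σ => σ ⊆ τ) = τ.powersetCard i := by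
  ext σ
  rw [mem_filter, mem_powersetCard]
  constructor
  · rintro ⟨h, hs⟩
    exact ⟨hs, X.card_mem i σ h⟩
  · rintro ⟨hs, hc⟩
    exact ⟨(X.downward i hi σ).2 ⟨hc, τ, hτ, hs⟩, hs⟩

lemma card_filter_subset (X : WSC n d) {i : ℕ} (hi : i < d) {τ : Finset (Fin n)}
    (hτ : τ ∈ X.faces (i + 1)) :
    (((X.faces i).filter (fun σ => σ ⊆ τ)).card : ℝ) = i + 1 := by
  rw [X.filter_subset_eq_powersetCard hi hτ, card_powersetCard, X.card_mem _ _ hτ]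
  simp

lemma sum_cofaces_w (X : WSC n d) {i : ℕ} (hi : i < d) {σ : Finset (Fin n)}
    (hσ : σ ∈ X.faces i) :
    ∑ τ ∈ (X.faces (i + 1)).filter (fun τ => σ ⊆ τ), X.w (i + 1) τ = (i + 1) * X.w i σ := by
  rw [X.w_rec i hi σ hσ]
  field_simp

lemma sum_subfaces (X : WSC n d) {i : ℕ} (hi : i < d) (a : Cf n) :
    ∑ τ ∈ X.faces (i + 1), X.w (i + 1) τ *
        ((1 / (i + 1 : ℝ)) * ∑ σ ∈ (X.faces i).filter (fun σ => σ ⊆ τ), a σ) =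
      ∑ σ ∈ X.faces i, X.w i σ * a σ := by
  have swap : ∑ τ ∈ X.faces (i + 1), ∑ σ ∈ (X.faces i).filter (fun σ => σ ⊆ τ),
        X.w (i + 1) τ * ((1 / (i + 1 : ℝ)) * a σ) =
      ∑ σ ∈ X.faces i, ∑ τ ∈ (X.faces (i + 1)).filter (fun τ => σ ⊆ τ),
        X.w (i + 1) τ * ((1 / (i + 1 : ℝ)) * a σ) :=
    sum_comm' (by intro x y; simp only [mem_filter]; tauto)
  simp only [mul_sum]
  rw [swap]
  refine sum_congr rfl fun σ hσ => ?_
  rw [← sum_mul, X.sum_cofaces_w hi hσ]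
  field_simp

lemma sum_cofaces (X : WSC n d) {i : ℕ} (hi : i < d) (a : Cf n) :
    ∑ σ ∈ X.faces i, (1 / (i + 1 : ℝ)) *
        ∑ τ ∈ (X.faces (i + 1)).filter (fun τ => σ ⊆ τ), X.w (i + 1) τ * a τ =
      ∑ τ ∈ X.faces (i + 1), X.w (i + 1) τ * a τ := by
  have swap : ∑ σ ∈ X.faces i, ∑ τ ∈ (X.faces (i + 1)).filter (fun τ => σ ⊆ τ),
        X.w (i + 1) τ * a τ =
      ∑ τ ∈ X.faces (i + 1), ∑ σ ∈ (X.faces i).filter (fun σ => σ ⊆ τ),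
        X.w (i + 1) τ * a τ :=
    sum_comm' (by intro x y; simp only [mem_filter]; tauto)
  rw [← mul_sum, swap, mul_sum]
  refine sum_congr rfl fun τ hτ => ?_
  rw [sum_const, nsmul_eq_mul, X.card_filter_subset hi hτ]
  field_simp

end WSC

/-- The iterated up operator as a linear map. -/
noncomputable def UcLin (X : WSC n d) (i m : ℕ) : Cf n →ₗ[ℝ] Cf n where
  toFun := Uc X i m
  map_add' f g := by
    induction m with
    | zero => rfl
    | succ m ih =>
      rw [Uc, ih]
      ext τ
      simp only [Uop, Uc, Pi.add_apply, sum_add_distrib, mul_add]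
  map_smul' c f := by
    induction m with
    | zero => rfl
    | succ m ih =>
      rw [Uc, ih]
      ext τ
      simp only [Uop, Uc, Pi.smul_apply, smul_eq_mul, ← mul_sum, RingHom.id_apply]
      ring

lemma UcLin_apply (X : WSC n d) (i m : ℕ) (f : Cf n) : UcLin X i m f = Uc X i m f := rfl

lemma Uc_Uc (X : WSC n d) (i a b : ℕ) (f : Cf n) :
    Uc X (i + a) b (Uc X i a f) = Uc X i (a + b) f := by
  induction b with
  | zero => rfl
  | succ b ih =>
    rw [Uc, ih, ← add_assoc a b 1, Uc, add_assoc]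

lemma sum_Ico_choose_mul_choose_alternating {l i : ℕ} (hl : l < i) :
    ∑ j ∈ Ico l i, (i.choose j : ℝ) * ((-1) ^ (j - l) * (j.choose l : ℝ)) =
      -((-1) ^ (i - l) * (i.choose l : ℝ)) := by
  have key : ∑ j ∈ Ico l (i + 1), (i.choose j : ℝ) * ((-1) ^ (j - l) * (j.choose l : ℝ)) = 0 := by
    have h := Int.alternating_sum_range_choose_of_ne (n := i - l) (by omega)
    have h' : ∑ m ∈ range (i - l + 1), (-1 : ℝ) ^ m * ((i - l).choose m : ℝ) = 0 := by
      exact_mod_cast h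
    calc _ = ∑ j ∈ Ico l (i + 1),
          (i.choose l : ℝ) * ((-1) ^ (j - l) * ((i - l).choose (j - l) : ℝ)) := by
          refine sum_congr rfl fun j hj => ?_
          rw [mem_Ico] at hj
          have hc : (i.choose j : ℝ) * (j.choose l : ℝ) =
              (i.choose l : ℝ) * ((i - l).choose (j - l) : ℝ) := by
            exact_mod_cast Nat.choose_mul (n := i) hj.1
          linear_combination (-1 : ℝ) ^ (j - l) * hc
      _ = 0 := by
          rw [← mul_sum, sum_Ico_eq_sum_range, show i + 1 - l = i - l + 1 by omega]
          simp only [Nat.add_sub_cancel_left]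
          rw [h', mul_zero]
  rw [sum_Ico_succ_top hl.le, Nat.choose_self] at key
  linear_combination key

/-- Binomial inversion of the recursion defining the Bottom-Up level functions. -/
lemma gLevel_eq_sum (X : WSC n d) (k : ℕ) (f : Cf n) (i : ℕ) :
    gLevel X k f i = ∑ l ∈ range (i + 1),
      ((-1 : ℝ) ^ (i - l) * (i.choose l : ℝ)) • Uc X l (i - l) (Dc X k (k - l) f) := by
  induction i using Nat.strong_induction_on with
  | _ i ih =>
    rw [gLevel, sum_attach (range i)
      (fun j => (i.choose j : ℝ) • Uc X j (i - j) (gLevel X k f j))]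
    have expand : ∀ j ∈ range i, (i.choose j : ℝ) • Uc X j (i - j) (gLevel X k f j) =
        ∑ l ∈ range (j + 1), ((i.choose j : ℝ) * ((-1 : ℝ) ^ (j - l) * (j.choose l : ℝ))) •
          Uc X l (i - l) (Dc X k (k - l) f) := by
      intro j hj
      rw [mem_range] at hj
      rw [ih j hj, ← UcLin_apply, map_sum, smul_sum]
      refine sum_congr rfl fun l hl => ?_
      rw [mem_range] at hl
      have hc := Uc_Uc X l (j - l) (i - j) (Dc X k (k - l) f)
      rw [show l + (j - l) = j by omega, show j - l + (i - j) = i - l by omega] at hc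
      rw [map_smul, UcLin_apply, hc, smul_smul]
    have swap : ∑ j ∈ range i, ∑ l ∈ range (j + 1),
          ((i.choose j : ℝ) * ((-1 : ℝ) ^ (j - l) * (j.choose l : ℝ))) •
            Uc X l (i - l) (Dc X k (k - l) f) =
        ∑ l ∈ range i, ∑ j ∈ Ico l i,
          ((i.choose j : ℝ) * ((-1 : ℝ) ^ (j - l) * (j.choose l : ℝ))) •
            Uc X l (i - l) (Dc X k (k - l) f) :=
      sum_comm' (by intro x y; simp only [mem_range, mem_Ico]; omega)
    rw [sum_congr rfl expand, swap, sum_range_succ, sub_eq_add_neg, ← sum_neg_distrib, add_comm]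
    congr 1
    · refine sum_congr rfl fun l hl => ?_
      rw [← sum_smul, sum_Ico_choose_mul_choose_alternating (mem_range.1 hl), neg_smul, neg_neg]
    · simp [Uc]

/-- The bound on Bottom-Up level functions holds for every family of seminorms on the levels
which the up and down operators contract. -/
lemma seminorm_gLevel_le (X : WSC n d) (N : ℕ → Seminorm ℝ (Cf n))
    (hU : ∀ i, i < d → ∀ h, N (i + 1) (Uop X i h) ≤ N i h)
    (hD : ∀ i, i < d → ∀ h, N i (Dop X i h) ≤ N (i + 1) h)
    {k : ℕ} (hk : k ≤ d) (f : Cf n) {i : ℕ} (hik : i ≤ k) :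
    N i (gLevel X k f i) ≤ (2 : ℝ) ^ i * N i (Dc X k (k - i) f) := by
  have hUc : ∀ j m h, j + m ≤ d → N (j + m) (Uc X j m h) ≤ N j h := by
    intro j m h hm
    induction m with
    | zero => exact le_rfl
    | succ m ih => exact (hU (j + m) (by omega) _).trans (ih (by omega))
  have hDc : ∀ a b, a + b ≤ k →
      N (k - (a + b)) (Dc X k (a + b) f) ≤ N (k - a) (Dc X k a f) := by
    intro a b hb
    induction b with
    | zero => exact le_rfl
    | succ b ih =>
      have h := hD (k - (a + b + 1)) (by omega) (Dc X k (a + b) f)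
      rw [show k - (a + b + 1) + 1 = k - (a + b) by omega] at h
      exact h.trans (ih (by omega))
  rw [gLevel_eq_sum]
  calc _ ≤ ∑ l ∈ range (i + 1), N i (((-1 : ℝ) ^ (i - l) * (i.choose l : ℝ)) •
          Uc X l (i - l) (Dc X k (k - l) f)) :=
        le_sum_of_subadditive (N i) (map_zero _).le (map_add_le_add (N i)) _ _
    _ ≤ ∑ l ∈ range (i + 1), (i.choose l : ℝ) * N i (Dc X k (k - i) f) := by
        refine sum_le_sum fun l hl => ?_
        rw [mem_range] at hl
        rw [map_smul_eq_mul, norm_mul, norm_pow, norm_neg, norm_one, one_pow, one_mul,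
          Real.norm_natCast]
        refine mul_le_mul_of_nonneg_left ?_ (Nat.cast_nonneg _)
        have h₁ := hUc l (i - l) (Dc X k (k - l) f) (by omega)
        have h₂ := hDc (k - i) (i - l) (by omega)
        rw [show l + (i - l) = i by omega] at h₁
        rw [show k - i + (i - l) = k - l by omega, show k - (k - l) = l by omega,
          show k - (k - i) = i by omega] at h₂
        exact h₁.trans h₂
    _ = _ := by
        rw [← sum_mul]
        congr 1
        exact_mod_cast Nat.sum_range_choose i

lemma abs_Uop_rpow_le (X : WSC n d) {i : ℕ} (hi : i < d) (h : Cf n) {p : ℝ} (hp : 1 ≤ p)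
    {τ : Finset (Fin n)} (hτ : τ ∈ X.faces (i + 1)) :
    |Uop X i h τ| ^ p ≤
      (1 / (i + 1 : ℝ)) * ∑ σ ∈ (X.faces i).filter (fun σ => σ ⊆ τ), |h σ| ^ p := by
  have jensen := Real.rpow_arith_mean_le_arith_mean_rpow
    ((X.faces i).filter (fun σ => σ ⊆ τ)) (fun _ => 1 / (i + 1 : ℝ)) (fun σ => |h σ|)
    (fun _ _ => by positivity)
    (by rw [sum_const, nsmul_eq_mul, X.card_filter_subset hi hτ]; field_simp)
    (fun _ _ => abs_nonneg _) hp
  rw [← mul_sum, ← mul_sum] at jensen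
  refine le_trans (Real.rpow_le_rpow (abs_nonneg _) ?_ (by linarith)) jensen
  rw [Uop, abs_mul, abs_of_pos (by positivity : (0 : ℝ) < 1 / (i + 1))]
  exact mul_le_mul_of_nonneg_left (abs_sum_le_sum_abs _ _) (by positivity)

lemma abs_Dop_rpow_le (X : WSC n d) {i : ℕ} (hi : i < d) (h : Cf n) {p : ℝ} (hp : 1 ≤ p)
    {σ : Finset (Fin n)} (hσ : σ ∈ X.faces i) :
    X.w i σ * |Dop X i h σ| ^ p ≤ (1 / (i + 1 : ℝ)) *
      ∑ τ ∈ (X.faces (i + 1)).filter (fun τ => σ ⊆ τ), X.w (i + 1) τ * |h τ| ^ p := by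
  have hw := X.w_pos i σ hσ
  have hW : 0 < (i + 1) * X.w i σ := by positivity
  have jensen := Real.rpow_arith_mean_le_arith_mean_rpow
    ((X.faces (i + 1)).filter (fun τ => σ ⊆ τ))
    (fun τ => X.w (i + 1) τ / ((i + 1) * X.w i σ)) (fun τ => |h τ|)
    (fun τ _ => div_nonneg (X.w_nonneg _ _) hW.le)
    (by rw [← sum_div, X.sum_cofaces_w hi hσ, div_self hW.ne'])
    (fun _ _ => abs_nonneg _) hp
  simp only [div_mul_eq_mul_div, ← sum_div] at jensen
  have habs : |Dop X i h σ| ≤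
      (∑ τ ∈ (X.faces (i + 1)).filter (fun τ => σ ⊆ τ), X.w (i + 1) τ * |h τ|) /
        ((i + 1) * X.w i σ) := by
    rw [Dop, X.sum_cofaces_w hi hσ, abs_div, abs_of_pos hW]
    refine div_le_div_of_nonneg_right ((abs_sum_le_sum_abs _ _).trans_eq ?_) hW.le
    exact sum_congr rfl fun τ _ => by rw [abs_mul, abs_of_nonneg (X.w_nonneg _ _)]
  calc _ ≤ X.w i σ * ((∑ τ ∈ (X.faces (i + 1)).filter (fun τ => σ ⊆ τ),
          X.w (i + 1) τ * |h τ| ^ p) / ((i + 1) * X.w i σ)) :=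
        mul_le_mul_of_nonneg_left
          ((Real.rpow_le_rpow (abs_nonneg _) habs (by linarith)).trans jensen) hw.le
    _ = _ := by field_simp

lemma sum_w_mul_abs_rpow_nonneg (X : WSC n d) (i : ℕ) (p : ℝ) (f : Cf n) :
    0 ≤ ∑ τ ∈ X.faces i, X.w i τ * |f τ| ^ p :=
  sum_nonneg fun τ _ => mul_nonneg (X.w_nonneg i τ) (Real.rpow_nonneg (abs_nonneg _) p)

lemma normP_eq_Lp (X : WSC n d) (i : ℕ) {p : ℝ} (hp : 1 ≤ p) (f : Cf n) :
    normP X i p f = (∑ τ ∈ X.faces i, |X.w i τ ^ (1 / p) * f τ| ^ p) ^ (1 / p) := by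
  rw [normP]
  congr 1
  refine sum_congr rfl fun τ _ => ?_
  have hw := X.w_nonneg i τ
  rw [abs_mul, abs_of_nonneg (Real.rpow_nonneg hw _),
    Real.mul_rpow (Real.rpow_nonneg hw _) (abs_nonneg _), ← Real.rpow_mul hw,
    one_div_mul_cancel (by linarith), Real.rpow_one]

/-- The `L^p` norm at level `i` as a seminorm. -/
noncomputable def normPSeminorm (X : WSC n d) {p : ℝ} (hp : 1 ≤ p) (i : ℕ) :
    Seminorm ℝ (Cf n) :=
  Seminorm.of (normP X i p)
    (fun f g => by
      simp only [normP_eq_Lp X i hp, Pi.add_apply, mul_add]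
      exact Real.Lp_add_le _ _ _ hp)
    (fun c f => by
      have hp0 : p ≠ 0 := by linarith
      have hs : ∑ τ ∈ X.faces i, X.w i τ * |(c • f) τ| ^ p =
          |c| ^ p * ∑ τ ∈ X.faces i, X.w i τ * |f τ| ^ p := by
        rw [mul_sum]
        refine sum_congr rfl fun τ _ => ?_
        rw [Pi.smul_apply, smul_eq_mul, abs_mul, Real.mul_rpow (abs_nonneg _) (abs_nonneg _)]
        ring
      rw [normP, hs, Real.mul_rpow (Real.rpow_nonneg (abs_nonneg _) _)
        (sum_w_mul_abs_rpow_nonneg X i p f), ← Real.rpow_mul (abs_nonneg _),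
        mul_one_div_cancel hp0, Real.rpow_one, normP, Real.norm_eq_abs])

lemma normP_Uop_le (X : WSC n d) {p : ℝ} (hp : 1 ≤ p) {i : ℕ} (hi : i < d) (h : Cf n) :
    normP X (i + 1) p (Uop X i h) ≤ normP X i p h := by
  refine Real.rpow_le_rpow (sum_w_mul_abs_rpow_nonneg X _ p _) ?_ (by positivity)
  rw [← X.sum_subfaces hi fun σ => |h σ| ^ p]
  exact sum_le_sum fun τ hτ =>
    mul_le_mul_of_nonneg_left (abs_Uop_rpow_le X hi h hp hτ) (X.w_nonneg _ _)

lemma normP_Dop_le (X : WSC n d) {p : ℝ} (hp : 1 ≤ p) {i : ℕ} (hi : i < d) (h : Cf n) :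
    normP X i p (Dop X i h) ≤ normP X (i + 1) p h := by
  refine Real.rpow_le_rpow (sum_w_mul_abs_rpow_nonneg X _ p _) ?_ (by positivity)
  rw [← X.sum_cofaces hi fun τ => |h τ| ^ p]
  exact sum_le_sum fun σ hσ => abs_Dop_rpow_le X hi h hp hσ

lemma abs_le_normInf (X : WSC n d) {i : ℕ} (f : Cf n) {τ : Finset (Fin n)}
    (hτ : τ ∈ X.faces i) : |f τ| ≤ normInf X i f :=
  le_ciSup (f := fun τ : {σ // σ ∈ X.faces i} => |f τ.1|) (Set.finite_range _).bddAbove ⟨τ, hτ⟩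

lemma normInf_nonneg (X : WSC n d) (i : ℕ) (f : Cf n) : 0 ≤ normInf X i f :=
  Real.iSup_nonneg fun _ => abs_nonneg _

lemma normInf_le (X : WSC n d) {i : ℕ} {f : Cf n} {a : ℝ} (ha : 0 ≤ a)
    (h : ∀ τ ∈ X.faces i, |f τ| ≤ a) : normInf X i f ≤ a :=
  Real.iSup_le (fun τ => h τ.1 τ.2) ha

/-- The `L^∞` norm at level `i` as a seminorm. -/
noncomputable def normInfSeminorm (X : WSC n d) (i : ℕ) : Seminorm ℝ (Cf n) :=
  Seminorm.of (normInf X i)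
    (fun f g => normInf_le X (add_nonneg (normInf_nonneg X i f) (normInf_nonneg X i g))
      fun _ hτ => (abs_add_le _ _).trans (add_le_add (abs_le_normInf X f hτ)
        (abs_le_normInf X g hτ)))
    (fun c f => by
      simp only [normInf, Pi.smul_apply, smul_eq_mul, abs_mul, Real.norm_eq_abs]
      exact (Real.mul_iSup_of_nonneg (abs_nonneg c) _).symm)

lemma normInf_Uop_le (X : WSC n d) {i : ℕ} (hi : i < d) (h : Cf n) :
    normInf X (i + 1) (Uop X i h) ≤ normInf X i h := by
  refine normInf_le X (normInf_nonneg X i h) fun τ hτ => ?_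
  have hmean := abs_Uop_rpow_le X hi h le_rfl hτ
  simp only [Real.rpow_one] at hmean
  have hsum := sum_le_card_nsmul ((X.faces i).filter (fun σ => σ ⊆ τ)) (fun σ => |h σ|) _
    fun σ hσ => abs_le_normInf X h (mem_filter.1 hσ).1
  rw [nsmul_eq_mul, X.card_filter_subset hi hτ] at hsum
  refine hmean.trans ((mul_le_mul_of_nonneg_left hsum (by positivity)).trans_eq ?_)
  field_simp

lemma normInf_Dop_le (X : WSC n d) {i : ℕ} (hi : i < d) (h : Cf n) :
    normInf X i (Dop X i h) ≤ normInf X (i + 1) h := by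
  refine normInf_le X (normInf_nonneg X _ h) fun σ hσ => ?_
  have hmean := abs_Dop_rpow_le X hi h le_rfl hσ
  simp only [Real.rpow_one] at hmean
  have hsum : ∑ τ ∈ (X.faces (i + 1)).filter (fun τ => σ ⊆ τ), X.w (i + 1) τ * |h τ| ≤
      (i + 1) * X.w i σ * normInf X (i + 1) h := by
    rw [← X.sum_cofaces_w hi hσ, sum_mul]
    exact sum_le_sum fun τ hτ => mul_le_mul_of_nonneg_left
      (abs_le_normInf X h (mem_filter.1 hτ).1) (X.w_nonneg _ _)
  refine le_of_mul_le_mul_left (hmean.trans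
    ((mul_le_mul_of_nonneg_left hsum (by positivity)).trans_eq ?_)) (X.w_pos i σ hσ)
  field_simp

/-- `p`-norm contraction of level functions: for any weighted pure
simplicial complex, `f ∈ C_k` and `i ≤ k`, the Bottom-Up level function satisfies
`‖g_i‖_p ≤ 2^i·‖D_i^k f‖_p` for every `p ∈ [1,∞]` (including `p = ∞`). -/
theorem stmt5 (n d : ℕ) (X : WSC n d) (k : ℕ) (hk : k ≤ d) (f : Cf n)
    (i : ℕ) (hik : i ≤ k) :
    (∀ p : ℝ, 1 ≤ p →
      normP X i p (gLevel X k f i) ≤ (2:ℝ)^i * normP X i p (Dc X k (k-i) f)) ∧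
    normInf X i (gLevel X k f i) ≤ (2:ℝ)^i * normInf X i (Dc X k (k-i) f) := by
  exact ⟨fun p hp => seminorm_gLevel_le X (normPSeminorm X hp)
      (fun _ hi h => normP_Uop_le X hp hi h) (fun _ hi h => normP_Dop_le X hp hi h) hk f hik,
    seminorm_gLevel_le X (normInfSeminorm X)
      (fun _ hi h => normInf_Uop_le X hi h) (fun _ hi h => normInf_Dop_le X hi h) hk f hik⟩
end

section
/- There is a universal constant C > 0 such that the following holds. Let (X,Π) be a two-sided γ-local-spectral expander and f ∈ C_k. Then for all 0 ≤ i < j ≤ k, the lifted Bottom-Up level functions are approximately orthogonal: |⟨f_i^↑, f_j^↑⟩| ≤ min{k^{C(i+j)}, 2^{Ck}}·γ·‖f‖₂². -/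
open Finset

variable {n d : ℕ}

namespace WSC

section Linear

variable (X : WSC n d)

/-- The up operator as a linear map. -/
noncomputable def up (k : ℕ) : Cf n →ₗ[ℝ] Cf n where
  toFun := Uop X k
  map_add' f g := by
    funext τ
    simp only [Uop, Pi.add_apply, sum_add_distrib, mul_add]
  map_smul' c f := by
    funext τ
    simp only [Uop, Pi.smul_apply, smul_eq_mul, ← mul_sum, RingHom.id_apply]
    ring

/-- The down operator as a linear map. -/
noncomputable def down (k : ℕ) : Cf n →ₗ[ℝ] Cf n where
  toFun := Dop X k
  map_add' f g := by
    funext τ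
    simp only [Dop, Pi.add_apply, mul_add, sum_add_distrib, add_div]
  map_smul' c f := by
    funext τ
    simp only [Dop, Pi.smul_apply, smul_eq_mul, mul_left_comm _ c, ← mul_sum, mul_div_assoc,
      RingHom.id_apply]

/-- The iterated up operator as a linear map. -/
noncomputable def upIter (i : ℕ) : ℕ → Cf n →ₗ[ℝ] Cf n
  | 0 => LinearMap.id
  | m + 1 => X.up (i + m) ∘ₗ upIter i m

theorem upIter_apply (i m : ℕ) (f : Cf n) : X.upIter i m f = Uc X i m f := by
  induction m with
  | zero => rfl
  | succ m ih => simp only [upIter, LinearMap.comp_apply, ih, Uc]; rfl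

theorem upIter_upIter (i a b : ℕ) (f : Cf n) :
    X.upIter (i + a) b (X.upIter i a f) = X.upIter i (a + b) f := by
  induction b with
  | zero => rfl
  | succ b ih => rw [← add_assoc, upIter, upIter, LinearMap.comp_apply, ih, add_assoc i a b]; rfl

theorem upIter_upIter_of_le {i l j : ℕ} (hil : i ≤ l) (hlj : l ≤ j) (f : Cf n) :
    X.upIter l (j - l) (X.upIter i (l - i) f) = X.upIter i (j - i) f := by
  obtain ⟨a, rfl⟩ := Nat.exists_eq_add_of_le hil
  obtain ⟨b, rfl⟩ := Nat.exists_eq_add_of_le hlj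
  rw [Nat.add_sub_cancel_left, Nat.add_sub_cancel_left, add_assoc i a b, Nat.add_sub_cancel_left,
    ← upIter_upIter]

/-- The embedding of `C_i` into a Euclidean space whose inner product is `ip X i`. -/
noncomputable def toEuclid (i : ℕ) : Cf n →ₗ[ℝ] EuclideanSpace ℝ (Finset (Fin n)) where
  toFun f := WithLp.toLp 2 fun τ => Real.sqrt (X.w i τ) * f τ
  map_add' f g := by ext τ; simp [mul_add]
  map_smul' c f := by ext τ; simp [mul_left_comm]

theorem ip_eq_sum_univ (i : ℕ) (f g : Cf n) : ip X i f g = ∑ τ, X.w i τ * f τ * g τ := by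
  refine sum_subset (subset_univ _) fun τ _ hτ => ?_
  rw [X.w_zero i τ hτ]; ring

theorem inner_toEuclid (i : ℕ) (f g : Cf n) :
    inner ℝ (X.toEuclid i f) (X.toEuclid i g) = ip X i f g := by
  rw [ip_eq_sum_univ, PiLp.inner_apply]
  refine sum_congr rfl fun τ _ => ?_
  have h := Real.mul_self_sqrt (X.w_nonneg i τ)
  simp only [toEuclid, LinearMap.coe_mk, AddHom.coe_mk, RCLike.inner_apply, conj_trivial]
  linear_combination f τ * g τ * h

theorem norm_toEuclid_sq (i : ℕ) (f : Cf n) : ‖X.toEuclid i f‖ ^ 2 = ip X i f f := by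
  rw [← inner_toEuclid, real_inner_self_eq_norm_sq]

theorem ip_comm (i : ℕ) (f g : Cf n) : ip X i f g = ip X i g f := by
  simp only [← inner_toEuclid, real_inner_comm]

theorem abs_ip_le (i : ℕ) (f g : Cf n) :
    |ip X i f g| ≤ ‖X.toEuclid i f‖ * ‖X.toEuclid i g‖ := by
  rw [← inner_toEuclid]; exact abs_real_inner_le_norm _ _

theorem ip_add_right (i : ℕ) (f g h : Cf n) : ip X i f (g + h) = ip X i f g + ip X i f h := by
  simp only [← inner_toEuclid, map_add, inner_add_right]

theorem ip_sub_right (i : ℕ) (f g h : Cf n) : ip X i f (g - h) = ip X i f g - ip X i f h := by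
  simp only [← inner_toEuclid, map_sub, inner_sub_right]

theorem ip_smul_right (i : ℕ) (c : ℝ) (f g : Cf n) : ip X i f (c • g) = c * ip X i f g := by
  simp only [← inner_toEuclid, map_smul, inner_smul_right]

theorem ip_smul_left (i : ℕ) (c : ℝ) (f g : Cf n) : ip X i (c • f) g = c * ip X i f g := by
  rw [ip_comm, ip_smul_right, ip_comm]

end Linear

section Operators

variable (X : WSC n d)

theorem sum_w_superfaces {i : ℕ} (hi : i < d) {s : Finset (Fin n)} (hs : s ∈ X.faces i) :
    ∑ t ∈ (X.faces (i + 1)).filter (fun t => s ⊆ t), X.w (i + 1) t = (i + 1) * X.w i s := by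
  rw [X.w_rec i hi s hs]
  field_simp

/-- Double counting of incident pairs of faces in consecutive levels. -/
theorem sum_w_mul_sum_subfaces {i : ℕ} (hi : i < d) (F : Cf n) :
    ∑ τ ∈ X.faces (i + 1), X.w (i + 1) τ * ∑ σ ∈ (X.faces i).filter (fun σ => σ ⊆ τ), F σ =
      (i + 1) * ∑ σ ∈ X.faces i, X.w i σ * F σ := by
  simp only [mul_sum, sum_filter]
  rw [sum_comm]
  refine sum_congr rfl fun σ hσ => ?_
  rw [← mul_assoc, ← X.sum_w_superfaces hi hσ, sum_mul, sum_filter]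
  exact sum_congr rfl fun τ _ => by split_ifs <;> simp

theorem ip_up_left {i : ℕ} (hi : i < d) (f g : Cf n) :
    ip X (i + 1) (X.up i f) g = ip X i f (X.down i g) := by
  have h : ∀ σ ∈ X.faces i, X.w i σ * f σ * X.down i g σ =
      (1 / (i + 1 : ℝ)) * ∑ τ ∈ X.faces (i + 1),
        if σ ⊆ τ then X.w (i + 1) τ * g τ * f σ else 0 := by
    intro σ hσ
    have hw := (X.w_pos i σ hσ).ne'
    change X.w i σ * f σ * Dop X i g σ = _
    rw [Dop, X.sum_w_superfaces hi hσ, ← sum_filter, ← sum_mul]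
    field_simp
  rw [ip, ip, sum_congr rfl h, ← mul_sum, sum_comm, mul_sum]
  refine sum_congr rfl fun τ _ => ?_
  change X.w (i + 1) τ * Uop X i f τ * g τ = _
  rw [Uop, ← sum_filter, ← mul_sum]
  ring

theorem card_subfaces_le {i : ℕ} {τ : Finset (Fin n)} (hτ : τ ∈ X.faces (i + 1)) :
    ((X.faces i).filter (fun σ => σ ⊆ τ)).card ≤ i + 1 := by
  have h : (X.faces i).filter (fun σ => σ ⊆ τ) ⊆ τ.powersetCard i := by
    intro σ hσ
    rw [mem_filter] at hσ
    exact mem_powersetCard.2 ⟨hσ.2, X.card_mem i σ hσ.1⟩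
  refine (card_le_card h).trans ?_
  rw [card_powersetCard, X.card_mem _ τ hτ, Nat.choose_succ_self_right]

theorem norm_up_le {i : ℕ} (hi : i < d) (f : Cf n) :
    ‖X.toEuclid (i + 1) (X.up i f)‖ ≤ ‖X.toEuclid i f‖ := by
  refine le_of_sq_le_sq ?_ (norm_nonneg _)
  rw [norm_toEuclid_sq, norm_toEuclid_sq]
  have key := X.sum_w_mul_sum_subfaces hi (fun σ => f σ ^ 2)
  have hpos : (0 : ℝ) < i + 1 := by positivity
  have h : ∀ τ ∈ X.faces (i + 1), X.w (i + 1) τ * X.up i f τ * X.up i f τ ≤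
      (1 / (i + 1 : ℝ)) *
        (X.w (i + 1) τ * ∑ σ ∈ (X.faces i).filter (fun σ => σ ⊆ τ), f σ ^ 2) := by
    intro τ hτ
    have h1 := sq_sum_le_card_mul_sum_sq (s := (X.faces i).filter (fun σ => σ ⊆ τ)) (f := f)
    have h2 : (((X.faces i).filter (fun σ => σ ⊆ τ)).card : ℝ) ≤ i + 1 := by
      exact_mod_cast X.card_subfaces_le hτ
    have h3 : (∑ σ ∈ (X.faces i).filter (fun σ => σ ⊆ τ), f σ) ^ 2 ≤
        (i + 1) * ∑ σ ∈ (X.faces i).filter (fun σ => σ ⊆ τ), f σ ^ 2 :=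
      h1.trans (mul_le_mul_of_nonneg_right h2 (sum_nonneg fun _ _ => sq_nonneg _))
    have hw : 0 ≤ X.w (i + 1) τ * (1 / (i + 1 : ℝ)) ^ 2 :=
      mul_nonneg (X.w_nonneg _ _) (sq_nonneg _)
    have h4 := mul_le_mul_of_nonneg_left h3 hw
    change X.w (i + 1) τ * Uop X i f τ * Uop X i f τ ≤ _
    rw [Uop]
    refine le_trans (le_of_eq (by ring)) (h4.trans (le_of_eq ?_))
    field_simp
  refine (sum_le_sum h).trans (le_of_eq ?_)
  rw [← mul_sum, key, ip]
  field_simp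

theorem norm_down_le {i : ℕ} (hi : i < d) (f : Cf n) :
    ‖X.toEuclid i (X.down i f)‖ ≤ ‖X.toEuclid (i + 1) f‖ := by
  have h1 : ‖X.toEuclid i (X.down i f)‖ ^ 2 ≤
      ‖X.toEuclid i (X.down i f)‖ * ‖X.toEuclid (i + 1) f‖ := by
    rw [norm_toEuclid_sq, ← ip_up_left X hi]
    refine (le_abs_self _).trans ((X.abs_ip_le _ _ _).trans ?_)
    exact mul_le_mul_of_nonneg_right (X.norm_up_le hi _) (norm_nonneg _)
  rcases (norm_nonneg (X.toEuclid i (X.down i f))).eq_or_lt with h | h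
  · rw [← h]; exact norm_nonneg _
  · rw [sq] at h1
    exact le_of_mul_le_mul_left h1 h

theorem norm_upIter_le {i m : ℕ} (him : i + m ≤ d) (f : Cf n) :
    ‖X.toEuclid (i + m) (X.upIter i m f)‖ ≤ ‖X.toEuclid i f‖ := by
  induction m with
  | zero => exact le_rfl
  | succ m ih =>
    have hi : i + m < d := by omega
    exact (X.norm_up_le hi _).trans (ih hi.le)

theorem norm_Dc_le {k m : ℕ} (hk : k ≤ d) (hm : m ≤ k) (f : Cf n) :
    ‖X.toEuclid (k - m) (Dc X k m f)‖ ≤ ‖X.toEuclid k f‖ := by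
  induction m with
  | zero => exact le_rfl
  | succ m ih =>
    refine le_trans ?_ (ih (by omega))
    have h := X.norm_down_le (i := k - (m + 1)) (by omega) (Dc X k m f)
    rwa [show k - (m + 1) + 1 = k - m by omega] at h

end Operators

section Spectral

variable (X : WSC n d)

theorem erase_mem_faces {m : ℕ} (hm : m < d) {τ : Finset (Fin n)} (hτ : τ ∈ X.faces (m + 1))
    {u : Fin n} (hu : u ∈ τ) : τ.erase u ∈ X.faces m := by
  rw [X.downward m hm]
  exact ⟨by rw [card_erase_of_mem hu, X.card_mem _ τ hτ, Nat.add_sub_cancel],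
    τ, hτ, erase_subset _ _⟩

theorem sum_subfaces_s6 {m : ℕ} (hm : m < d) {τ : Finset (Fin n)} (hτ : τ ∈ X.faces (m + 1))
    (F : Cf n) :
    ∑ σ ∈ (X.faces m).filter (fun σ => σ ⊆ τ), F σ = ∑ u ∈ τ, F (τ.erase u) := by
  have h : (X.faces m).filter (fun σ => σ ⊆ τ) = τ.image τ.erase := by
    ext σ
    simp only [mem_filter, mem_image]
    constructor
    · rintro ⟨hσ, hστ⟩
      have hc : (τ \ σ).card = 1 := by
        rw [card_sdiff_of_subset hστ, X.card_mem _ τ hτ, X.card_mem _ σ hσ]; omega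
      obtain ⟨u, hu⟩ := card_eq_one.1 hc
      have hu' : u ∈ τ \ σ := by rw [hu]; exact mem_singleton_self u
      refine ⟨u, (mem_sdiff.1 hu').1, ?_⟩
      rw [erase_eq, ← hu, Finset.sdiff_sdiff_eq_self hστ]
    · rintro ⟨u, hu, rfl⟩
      exact ⟨X.erase_mem_faces hm hτ hu, erase_subset _ _⟩
  rw [h, sum_image (erase_injOn τ)]

theorem sum_superfaces {m : ℕ} {s : Finset (Fin n)} (hs : s.card = m) (F : Cf n) :
    ∑ τ ∈ (X.faces (m + 1)).filter (fun τ => s ⊆ τ), F τ =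
      ∑ u, if u ∉ s ∧ insert u s ∈ X.faces (m + 1) then F (insert u s) else 0 := by
  rw [← sum_filter]
  have h : (X.faces (m + 1)).filter (fun τ => s ⊆ τ) =
      (univ.filter fun u => u ∉ s ∧ insert u s ∈ X.faces (m + 1)).image (insert · s) := by
    ext τ
    simp only [mem_filter, mem_image, mem_univ, true_and]
    constructor
    · rintro ⟨hτ, hsτ⟩
      have hc : (τ \ s).card = 1 := by
        rw [card_sdiff_of_subset hsτ, X.card_mem _ τ hτ, hs]; omega
      obtain ⟨u, hu⟩ := card_eq_one.1 hc
      have hu' : u ∈ τ \ s := by rw [hu]; exact mem_singleton_self u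
      have hτu : insert u s = τ := by
        rw [insert_eq, ← hu, sdiff_union_of_subset hsτ]
      exact ⟨u, ⟨(mem_sdiff.1 hu').2, hτu ▸ hτ⟩, hτu⟩
    · rintro ⟨u, ⟨_, hu⟩, rfl⟩
      exact ⟨hu, subset_insert _ _⟩
  rw [h, sum_image]
  intro u hu v _ huv
  have hu1 : u ∉ s := (mem_filter.1 hu).2.1
  have : u ∈ insert v s := by
    have huv' : insert u s = insert v s := huv
    rw [← huv']; exact mem_insert_self u s
  exact (mem_insert.1 this).resolve_right hu1

theorem edgeW_comm (m : ℕ) (s : Finset (Fin n)) (u v : Fin n) :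
    edgeW X m s u v = edgeW X m s v u := by
  simp only [edgeW, insert_comm u v s]
  congr 1
  exact propext ⟨fun h => ⟨h.1.symm, h.2.2.1, h.2.1, h.2.2.2⟩,
    fun h => ⟨h.1.symm, h.2.2.1, h.2.1, h.2.2.2⟩⟩

theorem vertW_eq {m : ℕ} (hm : m + 2 ≤ d) {s : Finset (Fin n)} (hs : s ∈ X.faces m) (u : Fin n) :
    vertW X m s u = if u ∉ s ∧ insert u s ∈ X.faces (m + 1)
      then (m + 2) * X.w (m + 1) (insert u s) else 0 := by
  have hsc := X.card_mem m s hs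
  split_ifs with h
  · have h1 := X.sum_w_superfaces (by omega : m + 1 < d) h.2
    rw [X.sum_superfaces (X.card_mem _ _ h.2)] at h1
    have h2 : ((m + 1 : ℕ) : ℝ) + 1 = m + 2 := by push_cast; ring
    rw [← h2, ← h1]
    refine sum_congr rfl fun v _ => ?_
    rw [edgeW, insert_comm u v s]
    refine if_congr ?_ rfl rfl
    simp only [mem_insert, not_or]
    exact ⟨fun a => ⟨⟨a.1.symm, a.2.2.1⟩, a.2.2.2⟩, fun a => ⟨Ne.symm a.1.1, h.1, a.1.2, a.2⟩⟩
  · refine sum_eq_zero fun v _ => if_neg ?_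
    rintro ⟨_, hu, _, hf⟩
    refine h ⟨hu, ?_⟩
    rw [X.downward (m + 1) (by omega)]
    exact ⟨by rw [card_insert_of_notMem hu, hsc], _, hf, insert_subset_insert _ (subset_insert _ _)⟩

theorem sum_vertW_mul {m : ℕ} (hm : m + 2 ≤ d) {s : Finset (Fin n)} (hs : s ∈ X.faces m)
    (F : Cf n) :
    ∑ u, vertW X m s u * F (insert u s) =
      (m + 2) * ∑ τ ∈ (X.faces (m + 1)).filter (fun τ => s ⊆ τ), X.w (m + 1) τ * F τ := by
  rw [X.sum_superfaces (X.card_mem m s hs), mul_sum]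
  refine sum_congr rfl fun u _ => ?_
  rw [X.vertW_eq hm hs]
  split_ifs <;> ring

/-- The up-walk cross terms, regrouped by the links of codimension-two faces. -/
theorem sum_offDiag_eq {m : ℕ} (hm : m + 2 ≤ d) (h : Cf n) :
    ∑ τ ∈ X.faces (m + 2), X.w (m + 2) τ *
        ∑ u ∈ τ, ∑ v ∈ τ, (if u ≠ v then h (τ.erase u) * h (τ.erase v) else 0) =
      ∑ s ∈ X.faces m, ∑ u, ∑ v, edgeW X m s u v * h (insert u s) * h (insert v s) := by
  have hL : ∀ τ ∈ X.faces (m + 2), X.w (m + 2) τ *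
        ∑ u ∈ τ, ∑ v ∈ τ, (if u ≠ v then h (τ.erase u) * h (τ.erase v) else 0) =
      ∑ u, ∑ v, if u ∈ τ ∧ v ∈ τ ∧ u ≠ v
        then X.w (m + 2) τ * h (τ.erase u) * h (τ.erase v) else 0 := by
    intro τ _
    rw [mul_sum, ← sum_subset (subset_univ τ)]
    · refine sum_congr rfl fun u hu => ?_
      rw [mul_sum, ← sum_subset (subset_univ τ)]
      · refine sum_congr rfl fun v hv => ?_
        by_cases huv : u = v <;> simp [hu, hv, huv, mul_assoc]
      · intro v _ hv; simp [hv]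
    · intro u _ hu; simp [hu]
  rw [sum_congr rfl hL, sum_comm, sum_comm (s := X.faces m)]
  refine sum_congr rfl fun u _ => ?_
  rw [sum_comm, sum_comm (s := X.faces m)]
  refine sum_congr rfl fun v _ => ?_
  simp only [edgeW, ite_mul, zero_mul]
  rw [← sum_filter, ← sum_filter]
  refine sum_nbij' (fun τ => (τ.erase u).erase v) (fun s => insert u (insert v s)) ?_ ?_ ?_ ?_ ?_
  · intro τ hτ
    obtain ⟨hτ, hu, hv, huv⟩ := mem_filter.1 hτ
    have hv' : v ∈ τ.erase u := mem_erase.2 ⟨huv.symm, hv⟩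
    refine mem_filter.2 ⟨X.erase_mem_faces (by omega)
      (X.erase_mem_faces (by omega) hτ hu) hv', huv, by simp, by simp, ?_⟩
    rwa [insert_erase hv', insert_erase hu]
  · intro s hs
    obtain ⟨_, huv, _, _, hf⟩ := mem_filter.1 hs
    exact mem_filter.2 ⟨hf, by simp, by simp, huv⟩
  · intro τ hτ
    obtain ⟨_, hu, hv, huv⟩ := mem_filter.1 hτ
    have hv' : v ∈ τ.erase u := mem_erase.2 ⟨huv.symm, hv⟩
    rw [insert_erase hv', insert_erase hu]
  · intro s hs
    obtain ⟨_, huv, hu, hv, _⟩ := mem_filter.1 hs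
    rw [erase_insert (by simp [huv, hu]), erase_insert hv]
  · intro τ hτ
    obtain ⟨_, hu, hv, huv⟩ := mem_filter.1 hτ
    have hv' : v ∈ τ.erase u := mem_erase.2 ⟨huv.symm, hv⟩
    have hu' : u ∈ τ.erase v := mem_erase.2 ⟨huv, hu⟩
    rw [insert_erase hv', insert_erase hu, erase_right_comm, insert_erase hu']
    ring

theorem ip_up_self {m : ℕ} (hm : m + 2 ≤ d) (h : Cf n) :
    (m + 2 : ℝ) ^ 2 * ip X (m + 2) (X.up (m + 1) h) (X.up (m + 1) h) =
      (m + 2) * ip X (m + 1) h h +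
        ∑ s ∈ X.faces m, ∑ u, ∑ v, edgeW X m s u v * h (insert u s) * h (insert v s) := by
  have hlt : m + 1 < d := by omega
  have hdiag := X.sum_w_mul_sum_subfaces hlt (fun σ => h σ ^ 2)
  have hcast : ((m + 1 : ℕ) : ℝ) + 1 = m + 2 := by push_cast; ring
  rw [hcast] at hdiag
  have e1 : ip X (m + 1) h h = ∑ σ ∈ X.faces (m + 1), X.w (m + 1) σ * h σ ^ 2 :=
    sum_congr rfl fun σ _ => by ring
  rw [e1, ← hdiag, ← X.sum_offDiag_eq hm, ← sum_add_distrib, ip, mul_sum]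
  refine sum_congr rfl fun τ hτ => ?_
  change (m + 2 : ℝ) ^ 2 * (X.w (m + 2) τ * Uop X (m + 1) h τ * Uop X (m + 1) h τ) = _
  rw [Uop, X.sum_subfaces_s6 hlt hτ, X.sum_subfaces_s6 hlt hτ, hcast, ← mul_add, ← sum_add_distrib]
  have h2 : ∀ u ∈ τ, h (τ.erase u) ^ 2 +
      ∑ v ∈ τ, (if u ≠ v then h (τ.erase u) * h (τ.erase v) else 0) =
        h (τ.erase u) * ∑ v ∈ τ, h (τ.erase v) := by
    intro u hu
    rw [mul_sum, ← add_sum_erase τ (fun v => h (τ.erase u) * h (τ.erase v)) hu, sq,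
      ← add_sum_erase τ _ hu]
    simp only [ne_eq, not_true_eq_false, if_false, zero_add]
    congr 1
    refine sum_congr rfl fun v hv => if_pos (ne_of_mem_erase hv).symm
  rw [sum_congr rfl h2, ← sum_mul]
  have : (m + 2 : ℝ) ≠ 0 := by positivity
  field_simp

theorem abs_link_form_sub_le {γ : ℝ} (hγ : 0 ≤ γ) (hX : IsLSE X γ) {m : ℕ} (hm : m + 2 ≤ d)
    (h : Cf n) {s : Finset (Fin n)} (hs : s ∈ X.faces m) :
    |(∑ u, ∑ v, edgeW X m s u v * h (insert u s) * h (insert v s)) -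
        (m + 2) * (m + 1) * (X.w m s * X.down m h s * X.down m h s)| ≤
      γ * ((m + 2) * ∑ τ ∈ (X.faces (m + 1)).filter (fun τ => s ⊆ τ),
        X.w (m + 1) τ * h τ ^ 2) := by
  have hw := X.sum_w_superfaces (by omega : m < d) hs
  have hwpos := X.w_pos m s hs
  set μ := X.down m h s with hμ
  have hμ' : ∑ τ ∈ (X.faces (m + 1)).filter (fun τ => s ⊆ τ), X.w (m + 1) τ * h τ =
      (m + 1) * X.w m s * μ := by
    change μ = Dop X m h s at hμ
    rw [Dop, hw] at hμ
    rw [hμ]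
    field_simp
  have hV1 : ∑ u, vertW X m s u * h (insert u s) = (m + 2) * ((m + 1) * X.w m s * μ) := by
    rw [X.sum_vertW_mul hm hs, hμ']
  have hV0 : ∑ u, vertW X m s u = (m + 2) * ((m + 1) * X.w m s) := by
    have := X.sum_vertW_mul hm hs (fun _ => 1)
    simp only [mul_one] at this
    rw [this, hw]
  have hV2 := X.sum_vertW_mul hm hs (fun τ => h τ ^ 2)
  have hmean : ∑ u, vertW X m s u * (h (insert u s) - μ) = 0 := by
    simp only [mul_sub, sum_sub_distrib, ← sum_mul, hV1, hV0]
    ring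
  have hlse := hX m hm s hs (fun u => h (insert u s) - μ) hmean
  have hcross : ∑ u, ∑ v, edgeW X m s u v * h (insert v s) =
      ∑ u, vertW X m s u * h (insert u s) := by
    rw [sum_comm]
    refine sum_congr rfl fun v _ => ?_
    rw [vertW, sum_mul]
    exact sum_congr rfl fun u _ => by rw [edgeW_comm]
  have hcross' : ∑ u, (∑ v, edgeW X m s u v) * h (insert u s) =
      ∑ u, vertW X m s u * h (insert u s) := rfl
  have hform : ∑ u, ∑ v, edgeW X m s u v * (h (insert u s) - μ) * (h (insert v s) - μ) =
      (∑ u, ∑ v, edgeW X m s u v * h (insert u s) * h (insert v s)) -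
        (m + 2) * (m + 1) * (X.w m s * μ * μ) := by
    have e : ∀ u v, edgeW X m s u v * (h (insert u s) - μ) * (h (insert v s) - μ) =
        edgeW X m s u v * h (insert u s) * h (insert v s) - edgeW X m s u v * h (insert u s) * μ
          - edgeW X m s u v * h (insert v s) * μ + edgeW X m s u v * (μ * μ) := by
      intro u v; ring
    simp only [e, sum_add_distrib, sum_sub_distrib, ← sum_mul, hcross, hcross', hV1]
    have : ∑ u, ∑ v, edgeW X m s u v = (m + 2) * ((m + 1) * X.w m s) := hV0
    rw [this]
    ring
  have hvar : ∑ u, vertW X m s u * (h (insert u s) - μ) ^ 2 ≤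
      ∑ u, vertW X m s u * h (insert u s) ^ 2 := by
    have e : ∀ u, vertW X m s u * (h (insert u s) - μ) ^ 2 =
        vertW X m s u * h (insert u s) ^ 2 - vertW X m s u * h (insert u s) * (2 * μ)
          + vertW X m s u * μ ^ 2 := by
      intro u; ring
    simp only [e, sum_add_distrib, sum_sub_distrib, ← sum_mul, hV1, hV0]
    have : 0 ≤ (m + 2 : ℝ) * ((m + 1) * X.w m s) * μ ^ 2 := by positivity
    linarith
  rw [hform] at hlse
  refine hlse.trans (mul_le_mul_of_nonneg_left ?_ hγ)
  rw [← hV2]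
  exact hvar

theorem sum_sum_superfaces_le {m : ℕ} (h : Cf n) :
    ∑ s ∈ X.faces m, ∑ τ ∈ (X.faces (m + 1)).filter (fun τ => s ⊆ τ), X.w (m + 1) τ * h τ ^ 2 ≤
      (m + 1) * ip X (m + 1) h h := by
  simp only [sum_filter]
  rw [sum_comm, ip, mul_sum]
  refine sum_le_sum fun τ hτ => ?_
  rw [← sum_filter, sum_const, nsmul_eq_mul]
  have h1 : (((X.faces m).filter (fun σ => σ ⊆ τ)).card : ℝ) ≤ m + 1 := by
    exact_mod_cast X.card_subfaces_le hτ
  have h2 : 0 ≤ X.w (m + 1) τ * h τ ^ 2 := mul_nonneg (X.w_nonneg _ _) (sq_nonneg _)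
  calc _ ≤ (m + 1 : ℝ) * (X.w (m + 1) τ * h τ ^ 2) := mul_le_mul_of_nonneg_right h1 h2
    _ = _ := by ring

/-- The defect in the commutation relation
`D_{i+1} U_i = (1/(i+1)) Id + (i/(i+1)) U_{i-1} D_i`. -/
noncomputable def commDefect (i : ℕ) : Cf n →ₗ[ℝ] Cf n :=
  X.down i ∘ₗ X.up i - (1 / (i + 1 : ℝ)) • LinearMap.id -
    ((i : ℝ) / (i + 1)) • (X.up (i - 1) ∘ₗ X.down (i - 1))

theorem ip_commDefect {m : ℕ} (hm : m + 2 ≤ d) (a b : Cf n) :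
    ip X (m + 1) a (X.commDefect (m + 1) b) =
      ip X (m + 2) (X.up (m + 1) a) (X.up (m + 1) b) - (1 / (m + 2 : ℝ)) * ip X (m + 1) a b -
        ((m + 1 : ℝ) / (m + 2)) * ip X m (X.down m a) (X.down m b) := by
  have h1 : ip X (m + 1) a (X.up m (X.down m b)) = ip X m (X.down m a) (X.down m b) := by
    rw [ip_comm, ip_up_left X (by omega), ip_comm]
  have hcast : ((m + 1 : ℕ) : ℝ) + 1 = m + 2 := by push_cast; ring
  simp only [commDefect, LinearMap.sub_apply, LinearMap.comp_apply, LinearMap.smul_apply,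
    LinearMap.id_apply, ip_sub_right, ip_smul_right, Nat.add_sub_cancel, hcast]
  rw [h1, ← ip_up_left X (by omega)]
  push_cast
  ring

theorem abs_ip_commDefect_self_le {γ : ℝ} (hγ : 0 ≤ γ) (hX : IsLSE X γ) {m : ℕ}
    (hm : m + 2 ≤ d) (h : Cf n) :
    |ip X (m + 1) h (X.commDefect (m + 1) h)| ≤ γ * ip X (m + 1) h h := by
  have hip : 0 ≤ ip X (m + 1) h h := by rw [← norm_toEuclid_sq]; positivity
  have hup := X.ip_up_self hm h
  have hsum : |(∑ s ∈ X.faces m, ∑ u, ∑ v, edgeW X m s u v * h (insert u s) * h (insert v s)) -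
      (m + 2) * (m + 1) * ip X m (X.down m h) (X.down m h)| ≤
        γ * ((m + 2) * ((m + 1) * ip X (m + 1) h h)) := by
    rw [ip, mul_sum, ← sum_sub_distrib]
    refine (abs_sum_le_sum_abs _ _).trans ?_
    refine (sum_le_sum fun s hs => X.abs_link_form_sub_le hγ hX hm h hs).trans ?_
    rw [← mul_sum, ← mul_sum]
    have := X.sum_sum_superfaces_le (m := m) h
    gcongr
  have heq : (m + 2 : ℝ) ^ 2 * ip X (m + 1) h (X.commDefect (m + 1) h) =
      (∑ s ∈ X.faces m, ∑ u, ∑ v, edgeW X m s u v * h (insert u s) * h (insert v s)) -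
        (m + 2) * (m + 1) * ip X m (X.down m h) (X.down m h) := by
    rw [X.ip_commDefect hm, mul_sub, mul_sub, hup]
    field_simp
    ring
  have hpos : (0 : ℝ) < (m + 2) ^ 2 := by positivity
  refine le_of_mul_le_mul_left ?_ hpos
  rw [← abs_of_pos hpos, ← abs_mul, abs_of_pos hpos, heq]
  refine hsum.trans ?_
  have : 0 ≤ γ * ip X (m + 1) h h := mul_nonneg hγ hip
  have hm0 : (0 : ℝ) ≤ m := Nat.cast_nonneg m
  nlinarith

theorem norm_commDefect_succ_le {γ : ℝ} (hγ : 0 ≤ γ) (hX : IsLSE X γ) {m : ℕ}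
    (hm : m + 2 ≤ d) (h : Cf n) :
    ‖X.toEuclid (m + 1) (X.commDefect (m + 1) h)‖ ≤ γ * ‖X.toEuclid (m + 1) h‖ := by
  set e := X.commDefect (m + 1) h with he
  have hsymm : ip X (m + 1) h (X.commDefect (m + 1) e) = ip X (m + 1) e e := by
    rw [he, X.ip_commDefect hm, ← he, ip_comm, ip_comm X (m + 1) h e, ip_comm X m,
      ← X.ip_commDefect hm]
  have hpoly : ∀ t : ℝ, 0 ≤ γ * ip X (m + 1) h h * (t * t) + -(2 * ip X (m + 1) e e) * t +
      γ * ip X (m + 1) e e := by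
    intro t
    have h1 := (abs_le.1 (X.abs_ip_commDefect_self_le hγ hX hm (e + t • h))).2
    have h2 := (abs_le.1 (X.abs_ip_commDefect_self_le hγ hX hm (e - t • h))).1
    rw [sub_eq_add_neg, ← neg_smul] at h2
    have expand : ∀ (a b : Cf n) (r : ℝ), ip X (m + 1) (a + r • b) (a + r • b) =
        ip X (m + 1) a a + 2 * r * ip X (m + 1) a b + r ^ 2 * ip X (m + 1) b b := by
      intro a b r
      rw [ip_add_right, ip_comm X _ (a + r • b) a, ip_comm X _ (a + r • b) (r • b),
        ip_add_right, ip_add_right, ip_smul_right, ip_smul_left, ip_smul_left, ip_smul_right,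
        ip_comm X _ b a]
      ring
    have expand' : ∀ r : ℝ,
        ip X (m + 1) (e + r • h) (X.commDefect (m + 1) (e + r • h)) =
        ip X (m + 1) e (X.commDefect (m + 1) e) + 2 * r * ip X (m + 1) e e +
          r ^ 2 * ip X (m + 1) h (X.commDefect (m + 1) h) := by
      intro r
      rw [map_add, map_smul, ← he, ip_add_right, ip_comm X _ (e + r • h),
        ip_comm X _ (e + r • h), ip_add_right, ip_add_right, ip_smul_right, ip_smul_left,
        ip_smul_left, ip_smul_right, ip_comm X _ _ h, hsymm, ip_comm X _ _ e,
        ip_comm X _ e h]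
      ring
    rw [expand, expand'] at h1 h2
    nlinarith
  have hdisc := discrim_le_zero hpoly
  rw [discrim] at hdisc
  rw [← norm_toEuclid_sq, ← norm_toEuclid_sq] at hdisc
  rcases (norm_nonneg (X.toEuclid (m + 1) e)).eq_or_lt with h0 | h0
  · rw [← h0]; positivity
  · refine le_of_sq_le_sq ?_ (by positivity)
    refine le_of_mul_le_mul_left ?_ (pow_pos h0 2)
    nlinarith

theorem norm_commDefect_le {γ : ℝ} (hγ : 0 ≤ γ) (hX : IsLSE X γ) {i : ℕ}
    (hi : i < d) (h : Cf n) :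
    ‖X.toEuclid i (X.commDefect i h)‖ ≤ (if i = 0 then 0 else γ) * ‖X.toEuclid i h‖ := by
  rcases i with _ | m
  · have hz : ∀ a, ip X 0 a (X.commDefect 0 h) = 0 := by
      intro a
      simp only [commDefect, LinearMap.sub_apply, LinearMap.comp_apply, LinearMap.smul_apply,
        LinearMap.id_apply, ip_sub_right, ip_smul_right]
      rw [← ip_up_left X hi]
      have key := X.sum_w_mul_sum_subfaces hi (fun σ => a σ * h σ)
      have hface : ∀ σ ∈ X.faces 0, σ = ∅ := fun σ hσ => card_eq_zero.1 (X.card_mem 0 σ hσ)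
      have hsub : ∀ (τ : Finset (Fin n)) (F : Cf n),
          ∑ σ ∈ (X.faces 0).filter (fun σ => σ ⊆ τ), F σ =
            if ∅ ∈ X.faces 0 then F ∅ else 0 := by
        intro τ F
        rw [sum_filter, sum_congr rfl (g := fun σ => if σ = ∅ then F ∅ else 0), sum_ite_eq']
        intro σ hσ
        rw [hface σ hσ]; simp
      simp only [hsub] at key
      have h1 : ip X (0 + 1) (X.up 0 a) (X.up 0 h) = ip X 0 a h := by
        have e : ip X 0 a h = ∑ σ ∈ X.faces 0, X.w 0 σ * (a σ * h σ) :=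
          sum_congr rfl fun _ _ => by ring
        rw [e]
        refine Eq.trans ?_ (key.trans (by simp))
        refine sum_congr rfl fun τ _ => ?_
        change X.w (0 + 1) τ * Uop X 0 a τ * Uop X 0 h τ = _
        simp only [Uop, hsub]
        split_ifs <;> simp [mul_assoc]
      rw [h1]
      simp
    have h2 := X.norm_toEuclid_sq 0 (X.commDefect 0 h)
    rw [hz, sq_eq_zero_iff] at h2
    rw [h2]; simp
  · simpa using X.norm_commDefect_succ_le hγ hX (by omega) h

end Spectral

section Levels

variable (X : WSC n d)

theorem up_upIter (j a : ℕ) (h : Cf n) :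
    X.up (j + a) (X.upIter j a h) = X.upIter j (a + 1) h := rfl

theorem norm_down_upIter_sub_le {k : ℕ} (hk : k ≤ d) {δ : ℝ}
    (hδ : ∀ i < k, ∀ h : Cf n, ‖X.toEuclid i (X.commDefect i h)‖ ≤ δ * ‖X.toEuclid i h‖)
    (hδ0 : 0 ≤ δ) (j a : ℕ) (hja : j + a + 1 ≤ k) (h : Cf n) :
    ‖X.toEuclid (j + a) (X.down (j + a) (X.upIter j (a + 1) h) -
        ((a + 1 : ℝ) / (j + a + 1)) • X.upIter j a h -
        ((j : ℝ) / (j + a + 1)) • X.upIter (j - 1) (a + 1) (X.down (j - 1) h))‖ ≤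
      (a + 1) * (δ * ‖X.toEuclid j h‖) := by
  induction a with
  | zero =>
    have := hδ j (by omega) h
    simpa [commDefect, upIter] using this
  | succ a ih =>
    have hshift : ((j : ℝ) / (j + a + 1)) •
          X.up (j + a) (X.upIter (j - 1) (a + 1) (X.down (j - 1) h)) =
        ((j : ℝ) / (j + a + 1)) • X.upIter (j - 1) (a + 2) (X.down (j - 1) h) := by
      rcases j with _ | q
      · simp
      · rw [← X.up_upIter (q + 1 - 1) (a + 1), show q + 1 - 1 + (a + 1) = q + 1 + a by omega]
    have hdecomp : X.down (j + (a + 1)) (X.upIter j (a + 1 + 1) h) -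
          (((a + 1 : ℕ) + 1 : ℝ) / (j + (a + 1 : ℕ) + 1)) • X.upIter j (a + 1) h -
          ((j : ℝ) / (j + (a + 1 : ℕ) + 1)) • X.upIter (j - 1) (a + 1 + 1) (X.down (j - 1) h) =
        X.commDefect (j + a + 1) (X.upIter j (a + 1) h) +
          ((j + a + 1 : ℝ) / (j + a + 2)) • X.up (j + a)
            (X.down (j + a) (X.upIter j (a + 1) h) -
              ((a + 1 : ℝ) / (j + a + 1)) • X.upIter j a h -
              ((j : ℝ) / (j + a + 1)) • X.upIter (j - 1) (a + 1) (X.down (j - 1) h)) := by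
      rw [map_sub, map_sub, map_smul, map_smul, hshift, up_upIter, commDefect,
        ← X.up_upIter j (a + 1)]
      simp only [LinearMap.sub_apply, LinearMap.comp_apply, LinearMap.smul_apply,
        LinearMap.id_apply, Nat.add_sub_cancel]
      push_cast
      have h1 : (j : ℝ) + a + 1 ≠ 0 := by positivity
      have h2 : (j : ℝ) + a + 2 ≠ 0 := by positivity
      have h3 : (j : ℝ) + (a + 1) + 1 = j + a + 2 := by ring
      have h4 : (j : ℝ) + a + 1 + 1 = j + a + 2 := by ring
      rw [h3, h4, ← add_assoc j a 1]
      match_scalars <;> field_simp <;> ring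
    rw [hdecomp, map_add, map_smul]
    have hlvl : ‖X.toEuclid (j + a + 1) (X.upIter j (a + 1) h)‖ ≤ ‖X.toEuclid j h‖ :=
      X.norm_upIter_le (m := a + 1) (by omega) h
    have b1 : ‖X.toEuclid (j + (a + 1)) (X.commDefect (j + a + 1) (X.upIter j (a + 1) h))‖ ≤
        δ * ‖X.toEuclid j h‖ :=
      (hδ (j + a + 1) (by omega) _).trans (mul_le_mul_of_nonneg_left hlvl hδ0)
    have b2 := (X.norm_up_le (i := j + a) (by omega) _).trans (ih (by omega))
    have hc : |(j + a + 1 : ℝ) / (j + a + 2)| ≤ 1 := by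
      rw [abs_of_nonneg (by positivity), div_le_one (by positivity)]
      linarith
    refine (norm_add_le _ _).trans ?_
    rw [norm_smul, Real.norm_eq_abs]
    have b3 := (mul_le_mul_of_nonneg_right hc (norm_nonneg _)).trans ((one_mul _).trans_le b2)
    have b4 := add_le_add b1 b3
    refine b4.trans (le_of_eq ?_)
    push_cast
    ring

/-- Pairing of functions lifted from levels `i < j`: if `D_j b` is small, the lifts are
almost orthogonal. -/
theorem abs_ip_upIter_upIter_le {k : ℕ} (hk : k ≤ d) {δ : ℝ}
    (hδ : ∀ i < k, ∀ h : Cf n, ‖X.toEuclid i (X.commDefect i h)‖ ≤ δ * ‖X.toEuclid i h‖)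
    (hδ0 : 0 ≤ δ) (i p r c : ℕ) (hir : i + r = p) (hc : p + 1 + c ≤ k) (a b : Cf n) :
    |ip X (p + 1 + c) (X.upIter i (r + 1 + c) a) (X.upIter (p + 1) c b)| ≤
      (c + 1) * (‖X.toEuclid i a‖ *
        (‖X.toEuclid p (X.down p b)‖ + k * (δ * ‖X.toEuclid (p + 1) b‖))) := by
  subst hir
  set A := ‖X.toEuclid i a‖
  set B := ‖X.toEuclid (i + r + 1) b‖
  set B' := ‖X.toEuclid (i + r) (X.down (i + r) b)‖
  have hA : 0 ≤ A := norm_nonneg _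
  have hB : 0 ≤ δ * B := mul_nonneg hδ0 (norm_nonneg _)
  have hB' : 0 ≤ B' := norm_nonneg _
  have hk0 : (0 : ℝ) ≤ k := Nat.cast_nonneg k
  induction c with
  | zero =>
    have h1 : ip X (i + r + 1) (X.upIter i (r + 1) a) b =
        ip X (i + r) (X.upIter i r a) (X.down (i + r) b) := by
      rw [← up_upIter, ip_up_left X (by omega)]
    have h2 : |ip X (i + r) (X.upIter i r a) (X.down (i + r) b)| ≤ A * B' :=
      (X.abs_ip_le _ _ _).trans
        (mul_le_mul_of_nonneg_right (X.norm_upIter_le (by omega) a) hB')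
    simp only [add_zero, upIter, LinearMap.id_apply, Nat.cast_zero, zero_add, one_mul]
    change |ip X (i + r + 1) (X.upIter i (r + 1) a) b| ≤ _
    rw [h1]
    nlinarith [mul_nonneg hA (mul_nonneg hk0 hB)]
  | succ c ih =>
    have ih := ih (by omega)
    have e1 : ip X (i + r + 1 + (c + 1)) (X.upIter i (r + 1 + (c + 1)) a)
          (X.upIter (i + r + 1) (c + 1) b) =
        ip X (i + r + 1 + c) (X.upIter i (r + 1 + c) a)
          (X.down (i + r + 1 + c) (X.upIter (i + r + 1) (c + 1) b)) := by
      rw [← add_assoc (r + 1) c 1, ← up_upIter, show i + (r + 1 + c) = i + r + 1 + c by omega]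
      have hlt : i + r + 1 + c < d := by omega
      exact ip_up_left X hlt _ _
    have hcomm := X.norm_down_upIter_sub_le hk hδ hδ0 (i + r + 1) c (by omega) b
    have hAn : ‖X.toEuclid (i + r + 1 + c) (X.upIter i (r + 1 + c) a)‖ ≤ A := by
      have := X.norm_upIter_le (i := i) (m := r + 1 + c) (by omega) a
      rwa [show i + (r + 1 + c) = i + r + 1 + c by omega] at this
    have hDn : ‖X.toEuclid (i + r + 1 + c) (X.upIter (i + r) (c + 1) (X.down (i + r) b))‖ ≤
        B' := by
      have := X.norm_upIter_le (i := i + r) (m := c + 1) (by omega) (X.down (i + r) b)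
      rwa [show i + r + (c + 1) = i + r + 1 + c by omega] at this
    rw [Nat.add_sub_cancel] at hcomm
    set x := X.upIter i (r + 1 + c) a
    set y := X.down (i + r + 1 + c) (X.upIter (i + r + 1) (c + 1) b)
    set α : ℝ := (c + 1 : ℝ) / (((i + r + 1 : ℕ) : ℝ) + c + 1) with hα
    set β : ℝ := ((i + r + 1 : ℕ) : ℝ) / (((i + r + 1 : ℕ) : ℝ) + c + 1) with hβ
    set z := X.upIter (i + r + 1) c b
    set t := X.upIter (i + r) (c + 1) (X.down (i + r) b)
    have hsplit : ip X (i + r + 1 + c) x y = ip X (i + r + 1 + c) x (y - α • z - β • t) +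
        α * ip X (i + r + 1 + c) x z + β * ip X (i + r + 1 + c) x t := by
      rw [ip_sub_right, ip_sub_right, ip_smul_right, ip_smul_right]; ring
    have hα1 : |α| ≤ 1 := by
      rw [hα, abs_of_nonneg (by positivity), div_le_one (by positivity)]
      push_cast
      have : (0 : ℝ) ≤ i := Nat.cast_nonneg i
      have : (0 : ℝ) ≤ r := Nat.cast_nonneg r
      linarith
    have hβ1 : |β| ≤ 1 := by
      rw [hβ, abs_of_nonneg (by positivity), div_le_one (by positivity)]
      have : (0 : ℝ) ≤ c := Nat.cast_nonneg c
      linarith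
    have hck : (c + 1 : ℝ) ≤ k := by
      have : c + 1 ≤ k := by omega
      exact_mod_cast this
    have b1 : |ip X (i + r + 1 + c) x (y - α • z - β • t)| ≤ A * (k * (δ * B)) := by
      refine (X.abs_ip_le _ _ _).trans (mul_le_mul hAn ?_ (norm_nonneg _) hA)
      exact hcomm.trans (mul_le_mul_of_nonneg_right hck hB)
    have b2 : |α * ip X (i + r + 1 + c) x z| ≤ (c + 1) * (A * (B' + k * (δ * B))) := by
      rw [abs_mul]
      exact (mul_le_mul_of_nonneg_right hα1 (abs_nonneg _)).trans ((one_mul _).trans_le ih)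
    have b3 : |β * ip X (i + r + 1 + c) x t| ≤ A * B' := by
      rw [abs_mul]
      refine (mul_le_mul_of_nonneg_right hβ1 (abs_nonneg _)).trans ((one_mul _).trans_le ?_)
      exact (X.abs_ip_le _ _ _).trans (mul_le_mul hAn hDn (norm_nonneg _) hA)
    rw [e1, hsplit]
    refine (abs_add_three _ _ _).trans ((add_le_add (add_le_add b1 b2) b3).trans (le_of_eq ?_))
    push_cast
    ring

theorem gLevel_eq (k : ℕ) (f : Cf n) (i : ℕ) :
    gLevel X k f i = Dc X k (k - i) f -
      ∑ l ∈ range i, (i.choose l : ℝ) • X.upIter l (i - l) (gLevel X k f l) := by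
  rw [gLevel, ← sum_attach (range i)]
  simp only [upIter_apply]

theorem alternating_sum_choose_mul_choose {t i : ℕ} (hti : t < i) :
    ∑ l ∈ range (i + 1), (-1 : ℝ) ^ (l + t) * ((i.choose l : ℝ) * (l.choose t : ℝ)) = 0 := by
  obtain ⟨m, rfl⟩ := Nat.exists_eq_add_of_le hti.le
  have hm : m ≠ 0 := by omega
  rw [add_assoc, sum_range_add]
  have h0 : ∑ l ∈ range t,
      (-1 : ℝ) ^ (l + t) * (((t + m).choose l : ℝ) * (l.choose t : ℝ)) = 0 :=
    sum_eq_zero fun l hl => by rw [Nat.choose_eq_zero_of_lt (mem_range.1 hl)]; simp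
  rw [h0, zero_add]
  have h1 : ∀ l ∈ range (m + 1), (-1 : ℝ) ^ (t + l + t) *
      (((t + m).choose (t + l) : ℝ) * ((t + l).choose t : ℝ)) =
        ((t + m).choose t : ℝ) * ((-1) ^ l * (m.choose l : ℝ)) := by
    intro l hl
    have hc := Nat.choose_mul (n := t + m) (k := t + l) (s := t) (by omega)
    rw [Nat.add_sub_cancel_left, Nat.add_sub_cancel_left] at hc
    have hc' : ((t + m).choose (t + l) : ℝ) * ((t + l).choose t : ℝ) =
        ((t + m).choose t : ℝ) * (m.choose l : ℝ) := by exact_mod_cast hc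
    have hs : (-1 : ℝ) ^ (t + l + t) = (-1) ^ l := by
      rw [show t + l + t = 2 * t + l by ring, pow_add, pow_mul]; simp
    rw [hc', hs]; ring
  rw [sum_congr rfl h1, ← mul_sum]
  have h2 := Int.alternating_sum_range_choose_of_ne hm
  have h3 : ∑ l ∈ range (m + 1), (-1 : ℝ) ^ l * (m.choose l : ℝ) = 0 := by exact_mod_cast h2
  rw [h3, mul_zero]

/-- Explicit form of the Bottom-Up level functions, by binomial inversion. -/
theorem gLevel_eq_sum (k : ℕ) (f : Cf n) (i : ℕ) :
    gLevel X k f i = ∑ t ∈ range (i + 1),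
      ((-1 : ℝ) ^ (i + t) * (i.choose t : ℝ)) • X.upIter t (i - t) (Dc X k (k - t) f) := by
  induction i using Nat.strong_induction_on with
  | _ i ih =>
    set E : ℕ → Cf n := fun t => X.upIter t (i - t) (Dc X k (k - t) f) with hE
    have hterm : ∀ l ∈ range i, (i.choose l : ℝ) • X.upIter l (i - l) (gLevel X k f l) =
        ∑ t ∈ range i,
          ((-1 : ℝ) ^ (l + t) * ((i.choose l : ℝ) * (l.choose t : ℝ))) • E t := by
      intro l hl
      have hl := mem_range.1 hl
      rw [ih l hl, map_sum, smul_sum]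
      have hsub : range (l + 1) ⊆ range i := range_subset_range.2 hl
      rw [← sum_subset hsub]
      · refine sum_congr rfl fun t ht => ?_
        have ht := mem_range.1 ht
        rw [map_smul, X.upIter_upIter_of_le (by omega) hl.le, smul_smul, hE]
        congr 1
        ring
      · intro t _ ht
        have ht : l < t := by simpa using ht
        rw [Nat.choose_eq_zero_of_lt ht]; simp
    rw [gLevel_eq, sum_congr rfl hterm, sum_comm, sum_range_succ]
    have hlast : ((-1 : ℝ) ^ (i + i) * (i.choose i : ℝ)) • E i = Dc X k (k - i) f := by
      rw [← two_mul, pow_mul]; simp [hE, upIter]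
    change _ = ∑ t ∈ range i, ((-1 : ℝ) ^ (i + t) * (i.choose t : ℝ)) • E t + _ • E i
    rw [hlast, sub_eq_add_neg, add_comm, ← sum_neg_distrib]
    congr 1
    refine sum_congr rfl fun t ht => ?_
    rw [← sum_smul, ← neg_smul]
    congr 1
    have h := alternating_sum_choose_mul_choose (mem_range.1 ht)
    rw [sum_range_succ, Nat.choose_self] at h
    push_cast at h
    linarith

theorem norm_Dc_level_le {k t : ℕ} (hk : k ≤ d) (ht : t ≤ k) (f : Cf n) :
    ‖X.toEuclid t (Dc X k (k - t) f)‖ ≤ ‖X.toEuclid k f‖ := by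
  have := X.norm_Dc_le (m := k - t) hk (by omega) f
  rwa [show k - (k - t) = t by omega] at this

theorem sum_range_choose_cast (i : ℕ) : ∑ t ∈ range (i + 1), (i.choose t : ℝ) = 2 ^ i := by
  exact_mod_cast Nat.sum_range_choose i

theorem norm_gLevel_le {k i : ℕ} (hk : k ≤ d) (hi : i ≤ k) (f : Cf n) :
    ‖X.toEuclid i (gLevel X k f i)‖ ≤ 2 ^ i * ‖X.toEuclid k f‖ := by
  rw [gLevel_eq_sum, map_sum, ← sum_range_choose_cast, sum_mul]
  refine norm_sum_le_of_le _ fun t ht => ?_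
  have ht : t ≤ i := Nat.lt_succ_iff.1 (mem_range.1 ht)
  rw [map_smul, norm_smul, norm_mul, norm_pow, norm_neg, norm_one, one_pow, one_mul,
    Real.norm_natCast]
  refine mul_le_mul_of_nonneg_left ?_ (Nat.cast_nonneg _)
  have h := X.norm_upIter_le (i := t) (m := i - t) (by omega) (Dc X k (k - t) f)
  rw [show t + (i - t) = i by omega] at h
  exact h.trans (X.norm_Dc_level_le hk (by omega) f)

theorem down_Dc {k p : ℕ} (hp : p + 1 ≤ k) (f : Cf n) :
    X.down p (Dc X k (k - (p + 1)) f) = Dc X k (k - p) f := by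
  rw [show k - p = (k - (p + 1)) + 1 by omega, Dc, show k - (k - (p + 1) + 1) = p by omega]
  rfl

/-- The exact commutation relation would annihilate `D_{p+1} g_{p+1}`. -/
theorem sum_commuted_eq {p : ℕ} (a : ℕ → Cf n) :
    ∑ t ∈ range (p + 1), ((-1 : ℝ) ^ (p + 1 + t) * ((p + 1).choose t : ℝ)) •
        (((p - t : ℕ) + 1 : ℝ) / (p + 1)) • a t +
      ∑ t ∈ range (p + 1), ((-1 : ℝ) ^ (p + 1 + t) * ((p + 1).choose t : ℝ)) •
        ((t : ℝ) / (p + 1)) • a (t - 1) + a p = 0 := by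
  have hp : (p + 1 : ℝ) ≠ 0 := by positivity
  have h1 : ∀ t ∈ range (p + 1), ((-1 : ℝ) ^ (p + 1 + t) * ((p + 1).choose t : ℝ)) •
      (((p - t : ℕ) + 1 : ℝ) / (p + 1)) • a t =
        ((-1 : ℝ) ^ (p + 1 + t) * (p.choose t : ℝ)) • a t := by
    intro t ht
    have ht : t ≤ p := Nat.lt_succ_iff.1 (mem_range.1 ht)
    have hc := Nat.choose_mul_succ_eq p t
    rw [show p + 1 - t = p - t + 1 by omega] at hc
    have hc' : (p.choose t : ℝ) * (p + 1) = ((p + 1).choose t : ℝ) * ((p - t : ℕ) + 1) := by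
      exact_mod_cast hc
    rw [smul_smul]
    congr 1
    field_simp
    linear_combination -hc'
  have h2 : ∀ t ∈ range p, ((-1 : ℝ) ^ (p + 1 + (t + 1)) * ((p + 1).choose (t + 1) : ℝ)) •
      (((t + 1 : ℕ) : ℝ) / (p + 1)) • a (t + 1 - 1) =
        -(((-1 : ℝ) ^ (p + 1 + t) * (p.choose t : ℝ)) • a t) := by
    intro t _
    have hc := Nat.add_one_mul_choose_eq p t
    have hc' : (p + 1 : ℝ) * (p.choose t : ℝ) = ((p + 1).choose (t + 1) : ℝ) * (t + 1) := by
      exact_mod_cast hc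
    rw [smul_smul, Nat.add_sub_cancel, ← neg_smul]
    congr 1
    push_cast
    field_simp
    rw [pow_add _ (p + 1) (t + 1), pow_succ, pow_add]
    linear_combination ((-1 : ℝ) ^ (p + 1) * (-1) ^ t) * hc'
  rw [sum_congr rfl h1, sum_range_succ, sum_range_succ' _ p, sum_congr rfl h2,
    sum_neg_distrib]
  have hs : (-1 : ℝ) ^ (p + 1 + p) = -1 := by
    rw [show p + 1 + p = 2 * p + 1 by ring, pow_succ, pow_mul]; simp
  simp [hs]

theorem norm_down_gLevel_le {k : ℕ} (hk : k ≤ d) {δ : ℝ}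
    (hδ : ∀ i < k, ∀ h : Cf n, ‖X.toEuclid i (X.commDefect i h)‖ ≤ δ * ‖X.toEuclid i h‖)
    (hδ0 : 0 ≤ δ) {p : ℕ} (hp : p + 1 ≤ k) (f : Cf n) :
    ‖X.toEuclid p (X.down p (gLevel X k f (p + 1)))‖ ≤
      2 ^ (p + 1) * (k * (δ * ‖X.toEuclid k f‖)) := by
  set F := ‖X.toEuclid k f‖
  set e : ℕ → Cf n := fun t => Dc X k (k - t) f with he
  set err : ℕ → Cf n := fun t => X.down p (X.upIter t (p + 1 - t) (e t)) -
    (((p - t : ℕ) + 1 : ℝ) / (p + 1)) • X.upIter t (p - t) (e t) -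
    ((t : ℝ) / (p + 1)) • X.upIter (t - 1) (p - (t - 1)) (e (t - 1)) with herr
  have hF : 0 ≤ δ * F := mul_nonneg hδ0 (norm_nonneg _)
  have herr_le : ∀ t ≤ p, ‖X.toEuclid p (err t)‖ ≤ k * (δ * F) := by
    intro t ht
    have h := X.norm_down_upIter_sub_le hk hδ hδ0 t (p - t) (by omega) (e t)
    rw [show t + (p - t) = p by omega, show (t : ℝ) + (p - t : ℕ) + 1 = p + 1 by
      rw [Nat.cast_sub ht]; ring] at h
    have hshift : ((t : ℝ) / (p + 1)) • X.upIter (t - 1) (p - t + 1) (X.down (t - 1) (e t)) =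
        ((t : ℝ) / (p + 1)) • X.upIter (t - 1) (p - (t - 1)) (e (t - 1)) := by
      rcases t with _ | q
      · simp
      · rw [Nat.add_sub_cancel, he, X.down_Dc (by omega), show p - (q + 1) + 1 = p - q by omega]
    rw [hshift, show p - t + 1 = p + 1 - t by omega] at h
    refine h.trans ?_
    have hk1 : ((p - t : ℕ) + 1 : ℝ) ≤ k := by
      have : p - t + 1 ≤ k := by omega
      exact_mod_cast this
    have he1 : ‖X.toEuclid t (e t)‖ ≤ F := X.norm_Dc_level_le hk (by omega) f
    exact mul_le_mul hk1 (mul_le_mul_of_nonneg_left he1 hδ0)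
      (mul_nonneg hδ0 (norm_nonneg _)) (Nat.cast_nonneg _)
  have hsum : X.down p (gLevel X k f (p + 1)) = ∑ t ∈ range (p + 1),
      ((-1 : ℝ) ^ (p + 1 + t) * ((p + 1).choose t : ℝ)) • err t := by
    have hcancel := sum_commuted_eq (p := p) fun t => X.upIter t (p - t) (e t)
    have hlast : X.down p (((-1 : ℝ) ^ (p + 1 + (p + 1)) * ((p + 1).choose (p + 1) : ℝ)) •
        X.upIter (p + 1) (p + 1 - (p + 1)) (e (p + 1))) = X.upIter p (p - p) (e p) := by
      rw [← two_mul, pow_mul, Nat.choose_self]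
      simp only [even_two, Even.neg_pow, one_pow, Nat.cast_one, one_mul, one_smul, Nat.sub_self,
        upIter, LinearMap.id_apply, he]
      exact X.down_Dc hp f
    rw [gLevel_eq_sum, sum_range_succ, map_add, hlast, map_sum]
    simp only [herr, smul_sub, sum_sub_distrib, map_smul]
    rw [sub_sub, eq_sub_iff_add_eq, ← sub_eq_zero, ← hcancel]
    abel
  rw [hsum, map_sum, ← sum_range_choose_cast, sum_mul]
  have hbound : ‖∑ t ∈ range (p + 1), X.toEuclid p
      (((-1 : ℝ) ^ (p + 1 + t) * ((p + 1).choose t : ℝ)) • err t)‖ ≤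
        ∑ t ∈ range (p + 1), ((p + 1).choose t : ℝ) * (k * (δ * F)) := by
    refine norm_sum_le_of_le _ fun t ht => ?_
    rw [map_smul, norm_smul, norm_mul, norm_pow, norm_neg, norm_one, one_pow, one_mul,
      Real.norm_natCast]
    exact mul_le_mul_of_nonneg_left (herr_le t (Nat.lt_succ_iff.1 (mem_range.1 ht)))
      (Nat.cast_nonneg _)
  refine hbound.trans ?_
  rw [sum_range_succ _ (p + 1)]
  exact le_add_of_nonneg_right (by positivity)

/-- Approximate orthogonality of the lifted level functions with an explicit constant. -/
theorem abs_ip_fLevel_le {γ : ℝ} (hγ : 0 ≤ γ) (hX : IsLSE X γ) {k : ℕ} (hk : k ≤ d) (f : Cf n)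
    {i j : ℕ} (hij : i < j) (hjk : j ≤ k) :
    |ip X k (fLevel X k f i) (fLevel X k f j)| ≤
      (k.choose i * k.choose j) * (2 * k ^ 2 * 2 ^ (i + j)) * ((k - 1) * γ) * ip X k f f := by
  have hk1 : (1 : ℝ) ≤ k := by
    have : 1 ≤ k := by omega
    exact_mod_cast this
  set δ : ℝ := (k - 1) * γ with hδdef
  have hδ0 : 0 ≤ δ := mul_nonneg (by linarith) hγ
  have hδ : ∀ i < k, ∀ h : Cf n,
      ‖X.toEuclid i (X.commDefect i h)‖ ≤ δ * ‖X.toEuclid i h‖ := by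
    intro i hi h
    refine (X.norm_commDefect_le hγ hX (by omega) h).trans
      (mul_le_mul_of_nonneg_right ?_ (norm_nonneg _))
    split_ifs with h0
    · exact hδ0
    · have : (2 : ℝ) ≤ k := by
        have : 2 ≤ k := by omega
        exact_mod_cast this
      rw [hδdef]
      nlinarith
  obtain ⟨r, rfl⟩ := Nat.exists_eq_add_of_lt hij
  obtain ⟨c, hc⟩ := Nat.exists_eq_add_of_le hjk
  have hpair := X.abs_ip_upIter_upIter_le hk hδ hδ0 i (i + r) r c rfl hc.ge
    (gLevel X k f i) (gLevel X k f (i + r + 1))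
  rw [← hc] at hpair
  have hg1 := X.norm_gLevel_le hk (by omega : i ≤ k) f
  have hg2 := X.norm_gLevel_le hk hjk f
  have hg3 := X.norm_down_gLevel_le hk hδ hδ0 hjk f
  set F := ‖X.toEuclid k f‖ with hFdef
  have hF0 : 0 ≤ F := norm_nonneg _
  have hc1 : (c + 1 : ℝ) ≤ k := by
    have : c + 1 ≤ k := by omega
    exact_mod_cast this
  have hpair' : |ip X k (X.upIter i (r + 1 + c) (gLevel X k f i))
      (X.upIter (i + r + 1) c (gLevel X k f (i + r + 1)))| ≤
        k * ((2 ^ i * F) * (2 ^ (i + r + 1) * (k * (δ * F)) +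
          k * (δ * (2 ^ (i + r + 1) * F)))) := by
    refine hpair.trans ?_
    gcongr
  rw [fLevel, fLevel, ip_smul_left, ip_smul_right, ← upIter_apply, ← upIter_apply,
    show k - i = r + 1 + c by omega, show k - (i + r + 1) = c by omega, abs_mul, abs_mul,
    Nat.abs_cast, Nat.abs_cast, ← norm_toEuclid_sq, ← hFdef, ← mul_assoc]
  have hcc : (0 : ℝ) ≤ (k.choose i : ℝ) * (k.choose (i + r + 1) : ℝ) := by positivity
  refine (mul_le_mul_of_nonneg_left hpair' hcc).trans (le_of_eq ?_)
  rw [pow_add 2 i]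
  ring

end Levels

end WSC

theorem choose_mul_choose_mul_le_rpow {k : ℕ} (hk : 2 ≤ k) {i j : ℕ} (hij : i < j) :
    ((k.choose i : ℝ) * k.choose j) * (2 * k ^ 2 * 2 ^ (i + j)) * (k - 1) ≤
      (k : ℝ) ^ ((8 : ℝ) * (i + j)) := by
  have hk2 : (2 : ℝ) ≤ k := by exact_mod_cast hk
  have hk0 : (0 : ℝ) ≤ k := by linarith
  have h1 : (k.choose i : ℝ) ≤ k ^ i := by exact_mod_cast Nat.choose_le_pow k i
  have h2 : (k.choose j : ℝ) ≤ k ^ j := by exact_mod_cast Nat.choose_le_pow k j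
  have h3 : (k : ℝ) - 1 ≤ k := by linarith
  have h4 : (0 : ℝ) ≤ k - 1 := by linarith
  have hr : (k : ℝ) ^ ((8 : ℝ) * (i + j)) = (k : ℝ) ^ (8 * (i + j)) := by
    rw [← Real.rpow_natCast]; push_cast; rfl
  rw [hr]
  calc ((k.choose i : ℝ) * k.choose j) * (2 * k ^ 2 * 2 ^ (i + j)) * (k - 1)
      ≤ ((k : ℝ) ^ i * k ^ j) * (k * k ^ 2 * (k : ℝ) ^ (i + j)) * k := by gcongr
    _ = (k : ℝ) ^ (2 * (i + j) + 4) := by ring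
    _ ≤ (k : ℝ) ^ (8 * (i + j)) := pow_le_pow_right₀ (by linarith) (by omega)

theorem choose_mul_choose_mul_le_two_rpow {k : ℕ} (hk : 2 ≤ k) {i j : ℕ} (hij : i < j) (hjk : j ≤ k) :
    ((k.choose i : ℝ) * k.choose j) * (2 * k ^ 2 * 2 ^ (i + j)) * (k - 1) ≤
      (2 : ℝ) ^ ((8 : ℝ) * k) := by
  have hk2 : (2 : ℝ) ≤ k := by exact_mod_cast hk
  have h1 : (k.choose i : ℝ) ≤ 2 ^ k := by exact_mod_cast Nat.choose_le_two_pow k i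
  have h2 : (k.choose j : ℝ) ≤ 2 ^ k := by exact_mod_cast Nat.choose_le_two_pow k j
  have hk' : (k : ℝ) ≤ 2 ^ k := by exact_mod_cast Nat.lt_two_pow_self.le
  have h3 : (k : ℝ) - 1 ≤ 2 ^ k := by linarith
  have h4 : (0 : ℝ) ≤ k - 1 := by linarith
  have hr : (2 : ℝ) ^ ((8 : ℝ) * k) = (2 : ℝ) ^ (8 * k) := by
    rw [← Real.rpow_natCast]; push_cast; rfl
  have h5 : (2 : ℝ) ^ (i + j + 1) ≤ 2 ^ (2 * k) := pow_le_pow_right₀ (by norm_num) (by omega)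
  rw [hr]
  calc ((k.choose i : ℝ) * k.choose j) * (2 * k ^ 2 * 2 ^ (i + j)) * (k - 1)
      = ((k.choose i : ℝ) * k.choose j) * (k ^ 2 * 2 ^ (i + j + 1)) * (k - 1) := by ring
    _ ≤ ((2 : ℝ) ^ k * 2 ^ k) * ((2 ^ k) ^ 2 * 2 ^ (2 * k)) * 2 ^ k := by gcongr
    _ = (2 : ℝ) ^ (7 * k) := by ring
    _ ≤ (2 : ℝ) ^ (8 * k) := pow_le_pow_right₀ (by norm_num) (by omega)

/-- approximate orthogonality of the Bottom-Up decomposition: there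
is a universal constant `C > 0` such that on any two-sided `γ`-local-spectral
expander, for `f ∈ C_k` and `0 ≤ i < j ≤ k`,
`|⟨f_i^↑, f_j^↑⟩| ≤ min{k^{C(i+j)}, 2^{Ck}}·γ·‖f‖₂²`. -/
theorem stmt6 : ∃ C : ℝ, 0 < C ∧
    ∀ (n d : ℕ) (X : WSC n d) (γ : ℝ), 0 ≤ γ → IsLSE X γ →
    ∀ (k : ℕ), k ≤ d → ∀ (f : Cf n) (i j : ℕ), i < j → j ≤ k →
    |ip X k (fLevel X k f i) (fLevel X k f j)| ≤
      min ((k:ℝ) ^ (C * ((i:ℝ) + (j:ℝ)))) ((2:ℝ) ^ (C * (k:ℝ))) * γ * ip X k f f := by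
  refine ⟨8, by norm_num, ?_⟩
  intro n d X γ hγ hX k hk f i j hij hjk
  have hmain := X.abs_ip_fLevel_le hγ hX hk f hij hjk
  have hip : 0 ≤ ip X k f f := by rw [← X.norm_toEuclid_sq]; positivity
  rcases (by omega : k = 1 ∨ 2 ≤ k) with rfl | hk2
  · refine hmain.trans ?_
    simp only [Nat.cast_one, sub_self, zero_mul, mul_zero]
    positivity
  · refine hmain.trans ?_
    rw [← mul_assoc]
    refine mul_le_mul_of_nonneg_right (mul_le_mul_of_nonneg_right ?_ hγ) hip
    exact le_min (choose_mul_choose_mul_le_rpow hk2 hij)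
      (choose_mul_choose_mul_le_two_rpow hk2 hij hjk)
end
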